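/- arXiv:2308.13455 — 3 statements merged into one kernel-verified Lean document; each statement's English description precedes it below -/
import Mathlib

section
/- Let H be a strictly 2-balanced graph with v_H vertices and e_H ≥ 2 edges. There exists n₀ such that for every n ≥ n₀, every p with n^{−1/m₂(H)} ≤ p ≤ 1, and every vertex v of the complete graph K_n: Pr(|∂𝓗_v[G_{n,p}]| ≥ 2·v_H·e_H·n^{v_H−1}·p^{e_H−1}) ≤ n^{−6}, where 𝓗_v is the hypergraph on vertex set E(K_n) whose hyperedges are the edge sets of copies of H in K_n that contain the vertex v. -/
open MeasureTheory Filter Topology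

noncomputable def bern (p : ℝ) : Measure Bool :=
  (ENNReal.ofReal p) • Measure.dirac true + (ENNReal.ofReal (1 - p)) • Measure.dirac false

noncomputable def gnp (n : ℕ) (p : ℝ) : Measure (Sym2 (Fin n) → Bool) :=
  Measure.pi fun _ => bern p

/-- The binomial random graph `G_{n,p}`, as a function of the Bernoulli sample `ω`. -/
def graphOf {n : ℕ} (ω : Sym2 (Fin n) → Bool) : SimpleGraph (Fin n) :=
  SimpleGraph.fromEdgeSet {e | ω e = true}

/-- The 2-density `m₂(H)`. -/
noncomputable def twoDensity {α : Type*} (H : SimpleGraph α) : ℝ :=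
  sSup {x : ℝ | ∃ F : H.Subgraph, 2 ≤ Nat.card F.edgeSet ∧
    x = ((Nat.card F.edgeSet : ℝ) - 1) / ((Nat.card F.verts : ℝ) - 2)}

/-- `H` is strictly 2-balanced. -/
def StrictlyTwoBalanced {α : Type*} (H : SimpleGraph α) : Prop :=
  ∀ F : H.Subgraph, 2 ≤ Nat.card F.edgeSet → F ≠ ⊤ →
    ((Nat.card F.edgeSet : ℝ) - 1) / ((Nat.card F.verts : ℝ) - 2) < twoDensity H

/-- The link `∂_e 𝓖 = {A ∖ {e} : e ∈ A ∈ 𝓖}` of a hypergraph whose vertices are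
potential edges. -/
def delH {β : Type*} (e : β) (Gc : Set (Set β)) : Set (Set β) :=
  {A | ∃ B ∈ Gc, e ∈ B ∧ A = B \ {e}}

/-- `∂𝓖 = ⋃_f ∂_f 𝓖`. -/
def bdH {β : Type*} (Gc : Set (Set β)) : Set (Set β) :=
  ⋃ e : β, delH e Gc

/-- The hypergraph (on vertex set `E(K_n)`) of edge sets of copies of `H` in `K_n`
containing the vertex `v`. -/
def copiesAt {V : Type*} (H : SimpleGraph V) (n : ℕ) (v : Fin n) : Set (Set (Sym2 (Fin n))) :=
  {E | ∃ f : V ↪ Fin n, v ∈ Set.range f ∧ E = Sym2.map f '' H.edgeSet}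

theorem bern_true (p : ℝ) : bern p {true} = ENNReal.ofReal p := by
  simp [bern]

theorem bern_isProbabilityMeasure {p : ℝ} (h0 : 0 ≤ p) (h1 : p ≤ 1) :
    IsProbabilityMeasure (bern p) := by
  refine ⟨?_⟩
  simp only [bern, Measure.add_apply, Measure.smul_apply, measure_univ, smul_eq_mul, mul_one]
  rw [← ENNReal.ofReal_add h0 (by linarith)]
  simp

theorem gnp_forall_true {n : ℕ} {p : ℝ} (h0 : 0 ≤ p) (h1 : p ≤ 1) (U : Finset (Sym2 (Fin n))) :
    gnp n p {ω | ∀ e ∈ U, ω e = true} = ENNReal.ofReal p ^ U.card := by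
  classical
  have := bern_isProbabilityMeasure h0 h1
  have hset : {ω : Sym2 (Fin n) → Bool | ∀ e ∈ U, ω e = true} =
      Set.univ.pi fun e => if e ∈ U then {true} else Set.univ := by
    ext ω
    simp only [Set.mem_ofPred_eq, Set.mem_univ_pi]
    refine forall_congr' fun e => ?_
    by_cases he : e ∈ U <;> simp [he]
  rw [hset, gnp, Measure.pi_pi]
  have : ∀ e : Sym2 (Fin n), bern p (if e ∈ U then {true} else Set.univ) =
      if e ∈ U then ENNReal.ofReal p else 1 := by
    intro e
    split_ifs
    · exact bern_true p
    · exact measure_univ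
  simp only [this, Finset.prod_ite_mem, Finset.univ_inter, Finset.prod_const]

open Classical in
/-- Moment bound for the number of sets of a family that are contained in the random set,
restricted to the event that the random set contains a given set `U`. -/
theorem lintegral_count_pow_le {n : ℕ} {p : ℝ} (h0 : 0 ≤ p) (h1 : p ≤ 1) {ι : Type*}
    (s : Finset ι) (A : ι → Finset (Sym2 (Fin n))) {r R : ℕ} {B : ℝ}
    (hA : ∀ t ∈ s, (A t).card ≤ r)
    (hB : ∀ U : Finset (Sym2 (Fin n)), U.card ≤ R → ∑ t ∈ s, p ^ (A t \ U).card ≤ B) (k : ℕ) :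
    ∀ U : Finset (Sym2 (Fin n)), U.card + r * k ≤ R →
      ∫⁻ ω, ((s.filter fun t => ∀ e ∈ A t, ω e = true).card : ENNReal) ^ k *
          (if ∀ e ∈ U, ω e = true then 1 else 0) ∂(gnp n p)
        ≤ ENNReal.ofReal B ^ k * ENNReal.ofReal p ^ U.card := by
  induction k with
  | zero =>
    intro U _
    simp only [pow_zero, one_mul]
    rw [← gnp_forall_true h0 h1 U, ← lintegral_indicator_one (MeasurableSet.of_discrete)]
    refine le_of_eq (lintegral_congr fun ω => ?_)
    simp [Set.indicator_apply]
  | succ k ih =>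
    intro U hU
    have hexp : ∀ ω : Sym2 (Fin n) → Bool,
        ((s.filter fun t => ∀ e ∈ A t, ω e = true).card : ENNReal) ^ (k + 1) *
          (if ∀ e ∈ U, ω e = true then 1 else 0) =
        ∑ t ∈ s, ((s.filter fun t => ∀ e ∈ A t, ω e = true).card : ENNReal) ^ k *
          (if ∀ e ∈ U ∪ A t, ω e = true then 1 else 0) := by
      intro ω
      rw [← Finset.mul_sum, pow_succ, mul_assoc]
      congr 1
      rw [Finset.card_filter, Nat.cast_sum, Finset.sum_mul]
      refine Finset.sum_congr rfl fun t _ => ?_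
      have : (∀ e ∈ U ∪ A t, ω e = true) ↔
          (∀ e ∈ A t, ω e = true) ∧ (∀ e ∈ U, ω e = true) := by
        simp only [Finset.mem_union, or_imp, forall_and]
        exact and_comm
      rw [if_congr this rfl rfl, ite_and]
      split_ifs <;> simp
    simp only [hexp]
    rw [lintegral_finsetSum _ fun t _ => Measurable.of_discrete]
    calc _ ≤ ∑ t ∈ s, ENNReal.ofReal B ^ k *
            (ENNReal.ofReal p ^ U.card * ENNReal.ofReal (p ^ (A t \ U).card)) := by
          refine Finset.sum_le_sum fun t ht => ?_
          have hc : (U ∪ A t).card = U.card + (A t \ U).card := by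
            rw [Finset.union_comm, ← Finset.card_sdiff_add_card (A t) U, add_comm]
          refine (ih (U ∪ A t) ?_).trans (le_of_eq ?_)
          · have := Finset.card_union_le U (A t)
            have := hA t ht
            rw [mul_add] at hU
            omega
          · rw [hc, pow_add, ENNReal.ofReal_pow h0]
      _ = ENNReal.ofReal B ^ k * ENNReal.ofReal p ^ U.card *
            ENNReal.ofReal (∑ t ∈ s, p ^ (A t \ U).card) := by
          rw [ENNReal.ofReal_sum_of_nonneg fun t _ => pow_nonneg h0 _, Finset.mul_sum]
          exact Finset.sum_congr rfl fun t _ => by ring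
      _ ≤ ENNReal.ofReal B ^ k * ENNReal.ofReal p ^ U.card * ENNReal.ofReal B := by
          gcongr
          exact hB U (by omega)
      _ = _ := by ring

open Classical in
theorem gnp_upper_tail {n : ℕ} {p : ℝ} (h0 : 0 ≤ p) (h1 : p ≤ 1) {ι : Type*}
    (s : Finset ι) (A : ι → Finset (Sym2 (Fin n))) {r k : ℕ} {M : ℝ} (hM : 0 < M)
    (hA : ∀ t ∈ s, (A t).card ≤ r)
    (hB : ∀ U : Finset (Sym2 (Fin n)), U.card ≤ r * k →
      ∑ t ∈ s, p ^ (A t \ U).card ≤ 3 / 2 * M)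
    {S : Set (Sym2 (Fin n) → Bool)}
    (hS : ∀ ω ∈ S, 2 * M ≤ ((s.filter fun t => ∀ e ∈ A t, ω e = true).card : ℝ)) :
    gnp n p S ≤ ENNReal.ofReal ((3 / 4) ^ k) := by
  have hmom := lintegral_count_pow_le h0 h1 s A hA hB k ∅ (by simp)
  simp only [Finset.notMem_empty, IsEmpty.forall_iff, implies_true, if_true, mul_one,
    Finset.card_empty, pow_zero] at hmom
  have hmarkov := mul_meas_ge_le_lintegral (μ := gnp n p)
    (f := fun ω => ((s.filter fun t => ∀ e ∈ A t, ω e = true).card : ENNReal) ^ k)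
    Measurable.of_discrete (ENNReal.ofReal (2 * M) ^ k)
  have hsub : S ⊆ {ω | ENNReal.ofReal (2 * M) ^ k ≤
      ((s.filter fun t => ∀ e ∈ A t, ω e = true).card : ENNReal) ^ k} := by
    intro ω hω
    rw [Set.mem_ofPred_eq]
    gcongr
    rw [← ENNReal.ofReal_natCast]
    exact ENNReal.ofReal_le_ofReal (hS ω hω)
  have hpos : ENNReal.ofReal (2 * M) ^ k ≠ 0 := pow_ne_zero _ (by simpa using hM)
  have htop : ENNReal.ofReal (2 * M) ^ k ≠ ⊤ := ENNReal.pow_ne_top ENNReal.ofReal_ne_top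
  refine (ENNReal.mul_le_mul_iff_right hpos htop).1 ?_
  calc _ ≤ _ := mul_le_mul_right (measure_mono hsub) _
    _ ≤ _ := hmarkov.trans hmom
    _ = _ := by
      rw [← ENNReal.ofReal_pow (by positivity), ← ENNReal.ofReal_pow (by positivity),
        ← ENNReal.ofReal_mul (by positivity), ← mul_pow]
      congr 2
      ring

theorem three_quarters_pow_ceil_log_le {n : ℕ} (hn : 1 ≤ n) :
    ((3 / 4 : ℝ)) ^ ⌈24 * Real.log n⌉₊ ≤ (n : ℝ) ^ (-(6 : ℝ)) := by
  have hn' : (0 : ℝ) < n := by exact_mod_cast hn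
  rw [← Real.rpow_natCast, Real.rpow_def_of_pos (by norm_num), Real.rpow_def_of_pos hn']
  refine Real.exp_le_exp.2 ?_
  have h1 := Real.log_le_sub_one_of_pos (show (0 : ℝ) < 3 / 4 by norm_num)
  have h2 := Nat.le_ceil (24 * Real.log n)
  nlinarith [Real.log_nonneg (show (1 : ℝ) ≤ n by exact_mod_cast hn)]

theorem eventually_mul_ceil_log_pow_le (C : ℝ) (d : ℕ) {δ : ℝ} (hδ : 0 < δ) :
    ∀ᶠ n : ℕ in atTop, C * ((⌈24 * Real.log n⌉₊ : ℝ) + 1) ^ d ≤ (n : ℝ) ^ δ := by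
  have ho := (isLittleO_log_rpow_rpow_atTop (d : ℝ) hδ).comp_tendsto
    (tendsto_natCast_atTop_atTop (R := ℝ))
  have hc : (0 : ℝ) < (|C| * 26 ^ d + 1)⁻¹ := by positivity
  filter_upwards [ho.bound hc, eventually_ge_atTop 3] with n hn h3
  have h3' : (3 : ℝ) ≤ n := by exact_mod_cast h3
  have hlog : 1 ≤ Real.log n := by
    rw [Real.le_log_iff_exp_le (by linarith)]
    linarith [Real.exp_one_lt_d9]
  simp only [Function.comp, Real.rpow_natCast] at hn
  rw [Real.norm_of_nonneg (by positivity), Real.norm_of_nonneg (by positivity),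
    inv_mul_eq_div, le_div_iff₀ (by positivity)] at hn
  have hk : (⌈24 * Real.log n⌉₊ : ℝ) + 1 ≤ 26 * Real.log n := by
    linarith [Nat.ceil_lt_add_one (show 0 ≤ 24 * Real.log n by positivity)]
  calc C * ((⌈24 * Real.log n⌉₊ : ℝ) + 1) ^ d
      ≤ |C| * (26 * Real.log n) ^ d := by
        gcongr
        exact le_abs_self C
    _ ≤ Real.log n ^ d * (|C| * 26 ^ d + 1) := by
        rw [mul_pow]
        nlinarith [pow_nonneg (zero_le_one.trans hlog) d]
    _ ≤ _ := hn

open Classical in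
/-- The set of endpoints of a finite set of edges. -/
noncomputable def edgeSupport {α : Type*} (J : Finset (Sym2 α)) : Finset α :=
  J.biUnion Sym2.toFinset

theorem mem_edgeSupport {α : Type*} {J : Finset (Sym2 α)} {a : α} :
    a ∈ edgeSupport J ↔ ∃ e ∈ J, a ∈ e := by
  simp [edgeSupport]

theorem card_edgeSupport_le {α : Type*} (J : Finset (Sym2 α)) :
    (edgeSupport J).card ≤ J.card * 2 := by
  classical
  refine Finset.card_biUnion_le_card_mul _ _ _ fun e _ => ?_
  rw [Sym2.card_toFinset]
  split_ifs <;> omega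

theorem card_le_card_edgeSupport_choose_two {α : Type*} {J : Finset (Sym2 α)}
    (hJ : ∀ e ∈ J, ¬e.IsDiag) : J.card ≤ (edgeSupport J).card.choose 2 := by
  classical
  rw [← Sym2.card_image_offDiag]
  refine Finset.card_le_card fun e he => ?_
  induction e using Sym2.ind with
  | _ a b =>
    refine Finset.mem_image.2 ⟨(a, b), Finset.mem_offDiag.2 ⟨?_, ?_, ?_⟩, rfl⟩
    · exact mem_edgeSupport.2 ⟨_, he, Sym2.mem_mk_left a b⟩
    · exact mem_edgeSupport.2 ⟨_, he, Sym2.mem_mk_right a b⟩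
    · exact fun h => hJ _ he (Sym2.mk_isDiag_iff.2 h)

theorem three_le_card_edgeSupport {α : Type*} {J : Finset (Sym2 α)}
    (hJ : ∀ e ∈ J, ¬e.IsDiag) (h2 : 2 ≤ J.card) : 3 ≤ (edgeSupport J).card := by
  by_contra! h
  have h1 := card_le_card_edgeSupport_choose_two hJ
  have h3 := Nat.choose_le_choose 2 (Nat.le_of_lt_succ h)
  simp at h3
  omega

/-- The subgraph formed by a set of edges and their endpoints. -/
def subgraphOfEdges {V : Type*} (H : SimpleGraph V) (J : Finset (Sym2 V))
    (hJ : ∀ e ∈ J, e ∈ H.edgeSet) : H.Subgraph where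
  verts := {a | ∃ e ∈ J, a ∈ e}
  Adj a b := s(a, b) ∈ J
  adj_sub h := hJ _ h
  edge_vert h := ⟨_, h, Sym2.mem_mk_left _ _⟩
  symm := ⟨fun a b h => by rwa [Sym2.eq_swap]⟩

theorem card_edgeSet_subgraphOfEdges {V : Type*} (H : SimpleGraph V) (J : Finset (Sym2 V))
    (hJ : ∀ e ∈ J, e ∈ H.edgeSet) : Nat.card (subgraphOfEdges H J hJ).edgeSet = J.card := by
  have : (subgraphOfEdges H J hJ).edgeSet = (J : Set (Sym2 V)) := by
    ext e
    induction e using Sym2.ind with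
    | _ a b => exact Iff.rfl
  rw [this]
  simp

theorem card_verts_subgraphOfEdges {V : Type*} (H : SimpleGraph V) (J : Finset (Sym2 V))
    (hJ : ∀ e ∈ J, e ∈ H.edgeSet) :
    Nat.card (subgraphOfEdges H J hJ).verts = (edgeSupport J).card := by
  have : (subgraphOfEdges H J hJ).verts = (edgeSupport J : Set V) := by
    ext a
    exact mem_edgeSupport.symm
  rw [this]
  simp

theorem finite_setOf_density {V : Type*} [Finite V] (H : SimpleGraph V) :
    {x : ℝ | ∃ F : H.Subgraph, 2 ≤ Nat.card F.edgeSet ∧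
      x = ((Nat.card F.edgeSet : ℝ) - 1) / ((Nat.card F.verts : ℝ) - 2)}.Finite := by
  refine (Set.finite_range fun F : H.Subgraph =>
    ((Nat.card F.edgeSet : ℝ) - 1) / ((Nat.card F.verts : ℝ) - 2)).subset ?_
  rintro x ⟨F, -, rfl⟩
  exact ⟨F, rfl⟩

theorem density_le_twoDensity {V : Type*} [Finite V] (H : SimpleGraph V) (F : H.Subgraph)
    (hF : 2 ≤ Nat.card F.edgeSet) :
    ((Nat.card F.edgeSet : ℝ) - 1) / ((Nat.card F.verts : ℝ) - 2) ≤ twoDensity H :=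
  le_csSup (finite_setOf_density H).bddAbove ⟨F, hF, rfl⟩

theorem StrictlyTwoBalanced.twoDensity_eq {V : Type*} [Finite V] {H : SimpleGraph V}
    (hbal : StrictlyTwoBalanced H) (h2 : 2 ≤ Nat.card H.edgeSet) :
    twoDensity H = ((Nat.card H.edgeSet : ℝ) - 1) / ((Nat.card V : ℝ) - 2) := by
  obtain ⟨F, hF, hx⟩ : twoDensity H ∈ _ :=
    Set.Nonempty.csSup_mem ⟨_, ⊤, by simpa using h2, rfl⟩ (finite_setOf_density H)
  by_cases hFt : F = ⊤
  · subst hFt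
    rw [hx]
    simp
  · exact absurd hx (hbal F hF hFt).ne'

theorem not_isDiag_of_subset_edgeSet {V : Type*} {H : SimpleGraph V} {J : Finset (Sym2 V)}
    (hJ : ∀ e ∈ J, e ∈ H.edgeSet) : ∀ e ∈ J, ¬e.IsDiag :=
  fun e he => H.not_isDiag_of_mem_edgeSet (hJ e he)

theorem card_sub_one_le_twoDensity_mul {V : Type*} [Finite V] {H : SimpleGraph V}
    {J : Finset (Sym2 V)} (hJ : ∀ e ∈ J, e ∈ H.edgeSet) (hne : J.Nonempty) :
    (J.card : ℝ) - 1 ≤ twoDensity H * ((edgeSupport J).card - 2) := by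
  classical
  have hd := not_isDiag_of_subset_edgeSet hJ
  rcases (Nat.succ_le_of_lt hne.card_pos).eq_or_lt with h1 | h2
  · obtain ⟨e, rfl⟩ := Finset.card_eq_one.1 h1.symm
    have : (edgeSupport {e}).card = 2 := by
      rw [edgeSupport, Finset.singleton_biUnion,
        Sym2.card_toFinset_of_not_isDiag _ (hd e (by simp))]
    simp [this]
  · have h3 := three_le_card_edgeSupport hd h2
    have h3' : (3 : ℝ) ≤ (edgeSupport J).card := by exact_mod_cast h3
    have := density_le_twoDensity H (subgraphOfEdges H J hJ)
      (by rw [card_edgeSet_subgraphOfEdges]; exact h2)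
    rwa [card_edgeSet_subgraphOfEdges, card_verts_subgraphOfEdges,
      div_le_iff₀ (by linarith)] at this

theorem StrictlyTwoBalanced.inv_lt_twoDensity {V : Type*} [Finite V] [DecidableEq V]
    {H : SimpleGraph V}
    (hbal : StrictlyTwoBalanced H) (h3 : 3 ≤ Nat.card H.edgeSet) {e f : Sym2 V}
    (he : e ∈ H.edgeSet) (hf : f ∈ H.edgeSet) (hef : e ≠ f) {d : ℕ}
    (hd : (edgeSupport {e, f}).card ≤ d) : 1 / ((d : ℝ) - 2) < twoDensity H := by
  have hJ : ∀ g ∈ ({e, f} : Finset (Sym2 V)), g ∈ H.edgeSet := by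
    simp [he, hf]
  have hc : ({e, f} : Finset (Sym2 V)).card = 2 := Finset.card_pair hef
  have h3' : (3 : ℝ) ≤ (edgeSupport {e, f}).card := by
    exact_mod_cast three_le_card_edgeSupport (not_isDiag_of_subset_edgeSet hJ) hc.ge
  have hlt := hbal (subgraphOfEdges H {e, f} hJ)
    (by rw [card_edgeSet_subgraphOfEdges, hc]) (by
      intro h
      have := card_edgeSet_subgraphOfEdges H {e, f} hJ
      rw [h, SimpleGraph.Subgraph.edgeSet_top, hc] at this
      omega)
  rw [card_edgeSet_subgraphOfEdges, card_verts_subgraphOfEdges, hc] at hlt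
  refine lt_of_le_of_lt ?_ hlt
  have hd' : ((edgeSupport {e, f}).card : ℝ) ≤ d := by exact_mod_cast hd
  norm_num
  exact inv_anti₀ (by linarith) (by linarith)

theorem StrictlyTwoBalanced.one_lt_twoDensity {V : Type*} [Fintype V] {H : SimpleGraph V}
    (hbal : StrictlyTwoBalanced H) (h3 : 3 ≤ Nat.card H.edgeSet) : 1 < twoDensity H := by
  classical
  have hE : Nat.card H.edgeSet = H.edgeFinset.card := by
    rw [Nat.card_eq_fintype_card, SimpleGraph.edgeFinset_card]
  have hsupp : ∀ e f : Sym2 V, edgeSupport {e, f} = e.toFinset ∪ f.toFinset := by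
    intro e f
    ext a
    simp [edgeSupport]
  by_cases hsh : ∃ e ∈ H.edgeFinset, ∃ f ∈ H.edgeFinset, e ≠ f ∧
      ¬Disjoint e.toFinset f.toFinset
  · obtain ⟨e, he, f, hf, hef, hdis⟩ := hsh
    rw [SimpleGraph.mem_edgeFinset] at he hf
    have := hbal.inv_lt_twoDensity h3 he hf hef (d := 3) (by
      have h1 := Sym2.card_toFinset_of_not_isDiag e (H.not_isDiag_of_mem_edgeSet he)
      have h2 := Sym2.card_toFinset_of_not_isDiag f (H.not_isDiag_of_mem_edgeSet hf)
      have h4 := Finset.card_union_add_card_inter e.toFinset f.toFinset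
      have h5 := Finset.card_pos.2 (Finset.not_disjoint_iff_nonempty_inter.1 hdis)
      rw [hsupp]
      omega)
    norm_num at this
    exact this
  · push Not at hsh
    exfalso
    obtain ⟨e, he, f, hf, hef⟩ := Finset.one_lt_card.1 (show 1 < H.edgeFinset.card by omega)
    rw [SimpleGraph.mem_edgeFinset] at he hf
    have hlt := hbal.inv_lt_twoDensity h3 he hf hef (d := 4) (by
      have := card_edgeSupport_le ({e, f} : Finset (Sym2 V))
      rwa [Finset.card_pair hef] at this)
    have hv : H.edgeFinset.card * 2 ≤ Fintype.card V := by
      have := Finset.card_biUnion (s := H.edgeFinset) (t := Sym2.toFinset)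
        fun e he f hf hef => hsh e he f hf hef
      rw [Finset.sum_const_nat (m := 2) fun e he => Sym2.card_toFinset_of_not_isDiag e
        (H.not_isDiag_of_mem_edgeSet (SimpleGraph.mem_edgeFinset.1 he))] at this
      rw [← this]
      exact Finset.card_le_univ _
    rw [hbal.twoDensity_eq (by omega), hE, Nat.card_eq_fintype_card] at hlt
    have hv' : (H.edgeFinset.card : ℝ) * 2 ≤ Fintype.card V := by exact_mod_cast hv
    have h3' : (3 : ℝ) ≤ H.edgeFinset.card := by exact_mod_cast hE ▸ h3
    norm_num at hlt
    rw [lt_div_iff₀ (by linarith)] at hlt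
    linarith

theorem card_functions_constrained {V : Type*} [Fintype V] [DecidableEq V] {n : ℕ}
    (S : Finset V) (W : Finset (Fin n)) :
    (Fintype.piFinset fun w : V => if w ∈ S then W else Finset.univ).card =
      W.card ^ S.card * n ^ (Fintype.card V - S.card) := by
  rw [Fintype.card_piFinset]
  have : ∀ w : V, (if w ∈ S then W else Finset.univ).card = if w ∈ S then W.card else n := by
    intro w
    split_ifs <;> simp
  simp only [this, Finset.prod_ite, Finset.prod_const]
  congr 2
  · congr 1
    ext
    simp
  · rw [Finset.filter_not, Finset.card_sdiff_of_subset (Finset.filter_subset _ _)]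
    simp

open Classical in
/-- Pairs of a placement `f` of `H` covering the vertex `v` and an edge of `H` to be removed. -/
noncomputable def placements {V : Type*} [Fintype V] (H : SimpleGraph V) (n : ℕ) (v : Fin n) :
    Finset ((V → Fin n) × Sym2 V) :=
  (Finset.univ.filter fun f : V → Fin n => Function.Injective f ∧ v ∈ Set.range f) ×ˢ
    H.edgeFinset

open Classical in
/-- The edge set of a copy of `H` with one edge removed. -/
noncomputable def placedEdges {V : Type*} [Fintype V] (H : SimpleGraph V) {n : ℕ}
    (t : (V → Fin n) × Sym2 V) : Finset (Sym2 (Fin n)) :=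
  (H.edgeFinset.erase t.2).image (Sym2.map t.1)

open Classical in
theorem card_placements_le {V : Type*} [Fintype V] (H : SimpleGraph V) (n : ℕ) (v : Fin n) :
    (placements H n v).card ≤
      Fintype.card V * n ^ (Fintype.card V - 1) * H.edgeFinset.card := by
  rw [placements, Finset.card_product]
  refine Nat.mul_le_mul_right _ ?_
  have hsub : (Finset.univ.filter fun f : V → Fin n =>
      Function.Injective f ∧ v ∈ Set.range f) ⊆
      Finset.univ.biUnion fun a : V =>
        Fintype.piFinset fun w : V => if w ∈ ({a} : Finset V) then {v} else Finset.univ := by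
    intro f hf
    obtain ⟨-, -, a, ha⟩ := Finset.mem_filter.1 hf
    refine Finset.mem_biUnion.2 ⟨a, Finset.mem_univ _, Fintype.mem_piFinset.2 fun w => ?_⟩
    by_cases hw : w = a
    · subst hw
      simp [ha]
    · simp [hw]
  refine (Finset.card_le_card hsub).trans ((Finset.card_biUnion_le_card_mul _ _
    (n ^ (Fintype.card V - 1)) fun a _ => ?_).trans (by rw [Finset.card_univ]))
  rw [card_functions_constrained]
  simp

open Classical in
theorem card_placedEdges_le {V : Type*} [Fintype V] (H : SimpleGraph V) {n : ℕ}
    (t : (V → Fin n) × Sym2 V) : (placedEdges H t).card ≤ H.edgeFinset.card :=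
  Finset.card_image_le.trans (Finset.card_le_card (Finset.erase_subset _ _))

/-- Few placements send all edges of `J` into a small set `U` of edges. -/
theorem card_filter_image_subset_le {V : Type*} [Fintype V] [DecidableEq V] {n : ℕ}
    (J : Finset (Sym2 V)) (U : Finset (Sym2 (Fin n))) :
    (Finset.univ.filter fun f : V → Fin n => ∀ e ∈ J, Sym2.map f e ∈ U).card ≤
      (U.card * 2) ^ (edgeSupport J).card * n ^ (Fintype.card V - (edgeSupport J).card) := by
  have hsub : (Finset.univ.filter fun f : V → Fin n => ∀ e ∈ J, Sym2.map f e ∈ U) ⊆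
      Fintype.piFinset fun w : V => if w ∈ edgeSupport J then edgeSupport U
        else Finset.univ := by
    intro f hf
    refine Fintype.mem_piFinset.2 fun w => ?_
    split_ifs with hw
    · obtain ⟨e, he, hwe⟩ := mem_edgeSupport.1 hw
      exact mem_edgeSupport.2
        ⟨_, (Finset.mem_filter.1 hf).2 e he, Sym2.mem_map.2 ⟨w, hwe, rfl⟩⟩
    · exact Finset.mem_univ _
  refine (Finset.card_le_card hsub).trans ?_
  rw [card_functions_constrained]
  gcongr
  exact card_edgeSupport_le U

open Classical in
theorem pow_card_placedEdges_sdiff_le {V : Type*} [Fintype V] (H : SimpleGraph V) {n : ℕ}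
    {p : ℝ} (h0 : 0 ≤ p) {t : (V → Fin n) × Sym2 V} (hinj : Function.Injective t.1)
    (ht : t.2 ∈ H.edgeFinset) (U : Finset (Sym2 (Fin n))) :
    p ^ (placedEdges H t \ U).card ≤ p ^ (H.edgeFinset.card - 1) +
      ∑ J ∈ H.edgeFinset.ssubsets.erase ∅,
        if ∀ e ∈ J, Sym2.map t.1 e ∈ U then p ^ (H.edgeFinset.card - 1 - J.card) else 0 := by
  set J₀ := (H.edgeFinset.erase t.2).filter fun e => Sym2.map t.1 e ∈ U with hJ₀
  have hcard : (placedEdges H t \ U).card = H.edgeFinset.card - 1 - J₀.card := by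
    have h1 : placedEdges H t \ U = ((H.edgeFinset.erase t.2) \ J₀).image (Sym2.map t.1) := by
      ext e
      simp only [placedEdges, Finset.mem_sdiff, Finset.mem_image, hJ₀, Finset.mem_filter]
      constructor
      · rintro ⟨⟨g, hg, rfl⟩, hU⟩
        exact ⟨g, ⟨hg, fun h => hU h.2⟩, rfl⟩
      · rintro ⟨g, ⟨hg, hU⟩, rfl⟩
        exact ⟨⟨g, hg, rfl⟩, fun h => hU ⟨hg, h⟩⟩
    rw [h1, Finset.card_image_of_injective _ (Sym2.map.injective hinj),
      Finset.card_sdiff_of_subset (Finset.filter_subset _ _), Finset.card_erase_of_mem ht]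
  have hnn : ∀ J ∈ H.edgeFinset.ssubsets.erase ∅, 0 ≤
      if ∀ e ∈ J, Sym2.map t.1 e ∈ U then p ^ (H.edgeFinset.card - 1 - J.card) else 0 := by
    intro J _
    split_ifs
    · exact pow_nonneg h0 _
    · exact le_rfl
  rw [hcard]
  by_cases hne : J₀ = ∅
  · rw [hne, Finset.card_empty, Nat.sub_zero]
    exact le_add_of_nonneg_right (Finset.sum_nonneg hnn)
  · have hmem : J₀ ∈ H.edgeFinset.ssubsets.erase ∅ := by
      refine Finset.mem_erase.2 ⟨hne, Finset.mem_ssubsets.2 ?_⟩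
      exact (Finset.filter_subset _ _).trans_ssubset (Finset.erase_ssubset ht)
    refine le_trans ?_ ((Finset.single_le_sum hnn hmem).trans
      (le_add_of_nonneg_left (pow_nonneg h0 _)))
    rw [if_pos fun e he => (Finset.mem_filter.1 he).2]

open Classical in
theorem sum_pow_card_placedEdges_sdiff_le {V : Type*} [Fintype V] (H : SimpleGraph V) {n : ℕ}
    {p : ℝ} (h0 : 0 ≤ p) (v : Fin n) (U : Finset (Sym2 (Fin n))) {B : ℝ}
    (hB : ∀ J ∈ H.edgeFinset.ssubsets.erase ∅,
      ((U.card * 2) ^ (edgeSupport J).card * n ^ (Fintype.card V - (edgeSupport J).card) : ℝ) *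
        p ^ (H.edgeFinset.card - 1 - J.card) ≤ B) (hB0 : 0 ≤ B) :
    ∑ t ∈ placements H n v, p ^ (placedEdges H t \ U).card ≤
      Fintype.card V * H.edgeFinset.card * n ^ (Fintype.card V - 1) *
        p ^ (H.edgeFinset.card - 1) +
      H.edgeFinset.card * 2 ^ H.edgeFinset.card * B := by
  have hstep : ∀ t ∈ placements H n v, p ^ (placedEdges H t \ U).card ≤
      p ^ (H.edgeFinset.card - 1) +
      ∑ J ∈ H.edgeFinset.ssubsets.erase ∅,
        if ∀ e ∈ J, Sym2.map t.1 e ∈ U then p ^ (H.edgeFinset.card - 1 - J.card) else 0 := by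
    intro t ht
    obtain ⟨h1, h2⟩ := Finset.mem_product.1 ht
    exact pow_card_placedEdges_sdiff_le H h0 (Finset.mem_filter.1 h1).2.1 h2 U
  refine (Finset.sum_le_sum hstep).trans ?_
  rw [Finset.sum_add_distrib]
  refine add_le_add ?_ ?_
  · rw [Finset.sum_const, nsmul_eq_mul]
    refine mul_le_mul_of_nonneg_right ?_ (pow_nonneg h0 _)
    have := card_placements_le H n v
    have : ((placements H n v).card : ℝ) ≤
      Fintype.card V * n ^ (Fintype.card V - 1) * H.edgeFinset.card := by exact_mod_cast this
    linarith
  · rw [Finset.sum_comm]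
    have hJ : ∀ J ∈ H.edgeFinset.ssubsets.erase ∅, (∑ t ∈ placements H n v,
        if ∀ e ∈ J, Sym2.map t.1 e ∈ U then p ^ (H.edgeFinset.card - 1 - J.card) else 0) ≤
        H.edgeFinset.card * B := by
      intro J hJ
      rw [← Finset.sum_filter, Finset.sum_const, nsmul_eq_mul]
      have hsub : (placements H n v).filter (fun t => ∀ e ∈ J, Sym2.map t.1 e ∈ U) ⊆
          (Finset.univ.filter fun f : V → Fin n => ∀ e ∈ J, Sym2.map f e ∈ U) ×ˢ
            H.edgeFinset := by
        intro t ht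
        obtain ⟨h1, h2⟩ := Finset.mem_filter.1 ht
        exact Finset.mem_product.2
          ⟨Finset.mem_filter.2 ⟨Finset.mem_univ _, h2⟩, (Finset.mem_product.1 h1).2⟩
      have hc := Finset.card_le_card hsub
      rw [Finset.card_product] at hc
      replace hc := hc.trans (Nat.mul_le_mul_right _ (card_filter_image_subset_le J U))
      have hc' : (((placements H n v).filter
          (fun t => ∀ e ∈ J, Sym2.map t.1 e ∈ U)).card : ℝ) ≤
          ((U.card * 2) ^ (edgeSupport J).card *
            n ^ (Fintype.card V - (edgeSupport J).card)) * H.edgeFinset.card := by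
        exact_mod_cast hc
      calc _ ≤ _ := mul_le_mul_of_nonneg_right hc' (pow_nonneg h0 _)
        _ = H.edgeFinset.card * (((U.card * 2) ^ (edgeSupport J).card *
              n ^ (Fintype.card V - (edgeSupport J).card)) *
              p ^ (H.edgeFinset.card - 1 - J.card)) := by ring
        _ ≤ _ := mul_le_mul_of_nonneg_left (hB J hJ) (Nat.cast_nonneg _)
    refine (Finset.sum_le_sum hJ).trans ?_
    rw [Finset.sum_const, nsmul_eq_mul]
    have hcard : ((H.edgeFinset.ssubsets.erase ∅).card : ℝ) ≤ 2 ^ H.edgeFinset.card := by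
      have : (H.edgeFinset.ssubsets.erase ∅).card ≤ H.edgeFinset.powerset.card :=
        Finset.card_le_card ((Finset.erase_subset _ _).trans (Finset.erase_subset _ _))
      rw [Finset.card_powerset] at this
      exact_mod_cast this
    calc _ ≤ (2 : ℝ) ^ H.edgeFinset.card * (H.edgeFinset.card * B) :=
          mul_le_mul_of_nonneg_right hcard (by positivity)
      _ = _ := by ring

open Classical in
theorem exists_placement_of_mem_bdH {V : Type*} [Fintype V] {H : SimpleGraph V} {n : ℕ}
    {v : Fin n} {A : Set (Sym2 (Fin n))} (hA : A ∈ bdH (copiesAt H n v)) :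
    ∃ t ∈ placements H n v, A = placedEdges H t := by
  obtain ⟨g, B, ⟨f, hv, rfl⟩, ⟨e, he, rfl⟩, rfl⟩ := Set.mem_iUnion.1 hA
  refine ⟨(f, e), Finset.mem_product.2 ⟨Finset.mem_filter.2 ⟨Finset.mem_univ _, f.injective, hv⟩,
    SimpleGraph.mem_edgeFinset.2 he⟩, ?_⟩
  rw [placedEdges, Finset.coe_image, Finset.coe_erase, SimpleGraph.coe_edgeFinset,
    Set.image_sdiff (Sym2.map.injective f.injective), Set.image_singleton]

theorem eq_true_of_subset_graphOf {n : ℕ} {ω : Sym2 (Fin n) → Bool}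
    {A : Finset (Sym2 (Fin n))} (h : (A : Set (Sym2 (Fin n))) ⊆ (graphOf ω).edgeSet) :
    ∀ e ∈ A, ω e = true := by
  intro e he
  have := h he
  rw [graphOf, SimpleGraph.edgeSet_fromEdgeSet] at this
  exact this.1

open Classical in
theorem natCard_le_card_filter {n : ℕ} {ι : Type*} (s : Finset ι)
    (A : ι → Finset (Sym2 (Fin n))) {G : Set (Set (Sym2 (Fin n)))}
    (hG : ∀ B ∈ G, ∃ t ∈ s, B = A t) (ω : Sym2 (Fin n) → Bool) :
    Nat.card {B ∈ G | B ⊆ (graphOf ω).edgeSet} ≤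
      (s.filter fun t => ∀ e ∈ A t, ω e = true).card := by
  have hsub : {B ∈ G | B ⊆ (graphOf ω).edgeSet} ⊆
      (((s.filter fun t => ∀ e ∈ A t, ω e = true).image fun t =>
        (A t : Set (Sym2 (Fin n))) : Finset _) : Set (Set (Sym2 (Fin n)))) := by
    rintro B ⟨hB, hω⟩
    obtain ⟨t, ht, rfl⟩ := hG B hB
    rw [Finset.mem_coe, Finset.mem_image]
    exact ⟨t, Finset.mem_filter.2 ⟨ht, eq_true_of_subset_graphOf hω⟩, rfl⟩
  rw [Nat.card_coe_set_eq]
  refine (Set.ncard_le_ncard hsub (Finset.finite_toSet _)).trans ?_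
  rw [Set.ncard_coe_finset]
  exact Finset.card_image_le

theorem rpow_le_pow_mul_pow_of_rpow_le {x p m a : ℝ} {s j : ℕ} (hx : 1 ≤ x)
    (hp : x ^ (-(1 / m)) ≤ p) (ha : a + j * (1 / m) ≤ s) : x ^ a ≤ x ^ s * p ^ j := by
  have hx0 : 0 < x := by linarith
  calc x ^ a ≤ x ^ ((s : ℝ) + -(1 / m) * j) :=
        Real.rpow_le_rpow_of_exponent_le hx (by linarith)
    _ = x ^ s * (x ^ (-(1 / m))) ^ j := by
        rw [Real.rpow_add hx0, Real.rpow_mul hx0.le, Real.rpow_natCast, Real.rpow_natCast]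
    _ ≤ _ := by gcongr

open Classical in
theorem StrictlyTwoBalanced.sum_pow_card_placedEdges_sdiff_le {V : Type*} [Fintype V]
    {H : SimpleGraph V} (hbal : StrictlyTwoBalanced H) (h3 : 3 ≤ H.edgeFinset.card)
    {n k : ℕ} (hn : 1 ≤ n) {p : ℝ} (hp : (n : ℝ) ^ (-(1 / twoDensity H)) ≤ p)
    (hk : 2 ^ (H.edgeFinset.card + 1) * (2 * H.edgeFinset.card : ℝ) ^ Fintype.card V *
      ((k : ℝ) + 1) ^ Fintype.card V ≤ (n : ℝ) ^ (1 - 1 / twoDensity H)) (v : Fin n)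
    (U : Finset (Sym2 (Fin n))) (hU : U.card ≤ H.edgeFinset.card * k) :
    ∑ t ∈ placements H n v, p ^ (placedEdges H t \ U).card ≤
      3 / 2 * (Fintype.card V * H.edgeFinset.card * n ^ (Fintype.card V - 1) *
        p ^ (H.edgeFinset.card - 1)) := by
  have hn' : (1 : ℝ) ≤ n := by exact_mod_cast hn
  have hn0 : (0 : ℝ) < n := by linarith
  have h0 : 0 ≤ p := (Real.rpow_nonneg hn0.le _).trans hp
  have hm : 1 < twoDensity H := hbal.one_lt_twoDensity (by
    rwa [Nat.card_eq_fintype_card, ← SimpleGraph.edgeFinset_card])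
  set m := twoDensity H with hmdef
  set e := H.edgeFinset.card with he
  set d := Fintype.card V with hd
  set Q : ℝ := n ^ (d - 1) * p ^ (e - 1) with hQ
  have hQ0 : 0 ≤ Q := by positivity
  set D : ℝ := (n : ℝ) ^ (1 - 1 / m) with hD
  have hD0 : 0 < D := Real.rpow_pos_of_pos hn0 _
  set K : ℝ := (2 * e : ℝ) ^ d * ((k : ℝ) + 1) ^ d with hK
  have hK0 : 0 ≤ K := by positivity
  have h3' : (3 : ℝ) ≤ e := by exact_mod_cast h3
  have hd1 : 1 ≤ d := by
    obtain ⟨g, -⟩ := Finset.card_pos.1 (show 0 < H.edgeFinset.card by omega)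
    induction g using Sym2.ind with
    | _ a b => exact Fintype.card_pos_iff.2 ⟨a⟩
  have hd1' : (1 : ℝ) ≤ d := by exact_mod_cast hd1
  refine (_root_.sum_pow_card_placedEdges_sdiff_le H h0 v U (B := K * (Q / D)) ?_
    (by positivity)).trans ?_
  · intro J hJ
    obtain ⟨hJne, hJss⟩ := Finset.mem_erase.1 hJ
    replace hJss := Finset.mem_ssubsets.1 hJss
    have hJne := Finset.nonempty_iff_ne_empty.2 hJne
    have hJe : ∀ e ∈ J, e ∈ H.edgeSet := fun e he => SimpleGraph.mem_edgeFinset.1 (hJss.1 he)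
    have hJlt : J.card < e := Finset.card_lt_card hJss
    have hJpos : 1 ≤ J.card := hJne.card_pos
    have hbd := card_sub_one_le_twoDensity_mul hJe hJne
    set s := (edgeSupport J).card with hs
    have hJpos' : (1 : ℝ) ≤ J.card := by exact_mod_cast hJpos
    have hs2 : (2 : ℝ) ≤ s := by
      have : (0 : ℝ) ≤ twoDensity H * (s - 2) := by linarith
      linarith [nonneg_of_mul_nonneg_right this (by linarith)]
    have hs2' : 2 ≤ s := by exact_mod_cast hs2
    have hsd : s ≤ d := Finset.card_le_univ _
    have hkey : D ≤ (n : ℝ) ^ (s - 1) * p ^ J.card := by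
      refine rpow_le_pow_mul_pow_of_rpow_le hn' hp ?_
      rw [Nat.cast_sub (by omega)]
      have : ((J.card : ℝ) - 1) * (1 / m) ≤ s - 2 := by
        rw [mul_one_div, div_le_iff₀ (by linarith), mul_comm]
        exact hbd
      push_cast
      linarith
    have hU1 : ((U.card : ℝ) * 2) ^ s ≤ K := by
      have hU' : (U.card : ℝ) ≤ e * k := by exact_mod_cast hU
      have h1 : (U.card : ℝ) * 2 ≤ 2 * e * ((k : ℝ) + 1) := by nlinarith
      have h2 : (1 : ℝ) ≤ 2 * e * ((k : ℝ) + 1) := by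
        nlinarith [Nat.cast_nonneg (α := ℝ) k]
      calc ((U.card : ℝ) * 2) ^ s ≤ (2 * e * ((k : ℝ) + 1)) ^ s := by gcongr
        _ ≤ (2 * e * ((k : ℝ) + 1)) ^ d := pow_le_pow_right₀ h2 hsd
        _ = K := mul_pow _ _ _
    have hQeq : Q = ((n : ℝ) ^ (d - s) * p ^ (e - 1 - J.card)) *
        ((n : ℝ) ^ (s - 1) * p ^ J.card) := by
      rw [mul_mul_mul_comm, ← pow_add, ← pow_add, hQ]
      congr 2 <;> omega
    rw [mul_assoc]
    refine mul_le_mul hU1 ?_ (by positivity) hK0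
    rw [le_div_iff₀ hD0, hQeq]
    exact mul_le_mul_of_nonneg_left hkey (by positivity)
  · have hKD : 2 ^ (e + 1) * (K * (Q / D)) ≤ Q := by
      rw [← mul_assoc, mul_div_assoc', div_le_iff₀ hD0, mul_comm Q]
      refine mul_le_mul_of_nonneg_right ?_ hQ0
      rw [hK, ← mul_assoc]
      exact hk
    have h4 : e * (2 ^ (e + 1) * (K * (Q / D))) ≤ e * (d * Q) :=
      mul_le_mul_of_nonneg_left (hKD.trans (le_mul_of_one_le_left hQ0 hd1')) (by positivity)
    have h5 : (d : ℝ) * e * n ^ (d - 1) * p ^ (e - 1) = e * (d * Q) := by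
      rw [hQ]
      ring
    rw [h5]
    rw [pow_succ] at h4
    linarith

theorem sum_pow_card_singleton_sdiff_le {n : ℕ} {p : ℝ} (h0 : 0 ≤ p)
    (U : Finset (Sym2 (Fin n))) :
    ∑ g : Sym2 (Fin n), p ^ ({g} \ U : Finset (Sym2 (Fin n))).card ≤ n ^ 2 * p + U.card := by
  have hstep : ∀ g : Sym2 (Fin n), p ^ ({g} \ U : Finset (Sym2 (Fin n))).card ≤
      p + if g ∈ U then 1 else 0 := by
    intro g
    by_cases hg : g ∈ U
    · rw [Finset.sdiff_eq_empty_iff_subset.2 (Finset.singleton_subset_iff.2 hg), if_pos hg]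
      simp [h0]
    · simp [hg, Finset.sdiff_eq_self_of_disjoint]
  refine (Finset.sum_le_sum fun g _ => hstep g).trans ?_
  rw [Finset.sum_add_distrib, Finset.sum_const, nsmul_eq_mul, Finset.sum_ite_mem,
    Finset.univ_inter, Finset.sum_const, nsmul_eq_mul, mul_one, Finset.card_univ]
  gcongr
  have : Fintype.card (Sym2 (Fin n)) ≤ Fintype.card (Fin n × Fin n) :=
    Fintype.card_le_of_surjective _ Sym2.mk_surjective
  rw [Fintype.card_prod, Fintype.card_fin] at this
  rw [sq]
  exact_mod_cast this

theorem stmt9 {V : Type} [Fintype V] (H : SimpleGraph V)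
    (hbal : StrictlyTwoBalanced H) (h2 : 2 ≤ Nat.card H.edgeSet) :
    ∃ n₀ : ℕ, ∀ n : ℕ, n₀ ≤ n → ∀ p : ℝ,
      (n : ℝ) ^ (-(1 / twoDensity H)) ≤ p → p ≤ 1 →
      ∀ v : Fin n,
        gnp n p {ω |
            2 * (Fintype.card V : ℝ) * (Nat.card H.edgeSet : ℝ) *
                (n : ℝ) ^ (Fintype.card V - 1) * p ^ (Nat.card H.edgeSet - 1)
              ≤ (Nat.card {A ∈ bdH (copiesAt H n v) | A ⊆ (graphOf ω).edgeSet} : ℝ)}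
          ≤ ENNReal.ofReal ((n : ℝ) ^ (-(6 : ℝ))) := by
  classical
  have hE : Nat.card H.edgeSet = H.edgeFinset.card := by
    rw [Nat.card_eq_fintype_card, SimpleGraph.edgeFinset_card]
  have hEd : ∀ e ∈ H.edgeFinset, e ∈ H.edgeSet := fun e => SimpleGraph.mem_edgeFinset.1
  have hd3 : 3 ≤ Fintype.card V :=
    (three_le_card_edgeSupport (not_isDiag_of_subset_edgeSet hEd) (hE ▸ h2)).trans
      (Finset.card_le_univ _)
  have hd3' : (3 : ℝ) ≤ Fintype.card V := by exact_mod_cast hd3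
  suffices h : ∀ᶠ n : ℕ in atTop, ∀ p : ℝ, (n : ℝ) ^ (-(1 / twoDensity H)) ≤ p → p ≤ 1 →
      ∀ v : Fin n, ∃ (ι : Type) (s : Finset ι) (A : ι → Finset (Sym2 (Fin n))) (r : ℕ),
        (∀ B ∈ bdH (copiesAt H n v), ∃ t ∈ s, B = A t) ∧ (∀ t ∈ s, (A t).card ≤ r) ∧
        ∀ U : Finset (Sym2 (Fin n)), U.card ≤ r * ⌈24 * Real.log n⌉₊ →
          ∑ t ∈ s, p ^ (A t \ U).card ≤ 3 / 2 * (Fintype.card V * H.edgeFinset.card *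
            n ^ (Fintype.card V - 1) * p ^ (H.edgeFinset.card - 1)) by
    obtain ⟨n₀, hn₀⟩ := eventually_atTop.1 (h.and (eventually_ge_atTop 1))
    refine ⟨n₀, fun n hn p hp hp1 v => ?_⟩
    obtain ⟨hfam, hn1⟩ := hn₀ n hn
    obtain ⟨ι, s, A, r, hG, hA, hB⟩ := hfam p hp hp1 v
    have hn0 : (0 : ℝ) < n := by exact_mod_cast hn1
    have hp0 : 0 < p := (Real.rpow_pos_of_pos hn0 _).trans_le hp
    have he0 : (0 : ℝ) < H.edgeFinset.card := by
      rw [hE] at h2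
      exact_mod_cast (show 0 < H.edgeFinset.card by omega)
    refine (gnp_upper_tail hp0.le hp1 s A (by positivity) hA hB fun ω hω => ?_).trans
      (ENNReal.ofReal_le_ofReal (three_quarters_pow_ceil_log_le hn1))
    rw [Set.mem_ofPred_eq, hE] at hω
    have hcount : (Nat.card {B ∈ bdH (copiesAt H n v) | B ⊆ (graphOf ω).edgeSet} : ℝ) ≤
        ((s.filter fun t => ∀ e ∈ A t, ω e = true).card : ℝ) := by
      exact_mod_cast natCard_le_card_filter s A hG ω
    refine le_trans (le_of_eq ?_) (hω.trans hcount)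
    ring
  rcases h2.eq_or_lt with h2 | h3
  · have he2 : H.edgeFinset.card = 2 := by omega
    have hm : 1 / twoDensity H = (Fintype.card V : ℝ) - 2 := by
      rw [hbal.twoDensity_eq h2.le, ← h2, Nat.card_eq_fintype_card]
      norm_num
    filter_upwards [eventually_mul_ceil_log_pow_le 1 1 one_pos, eventually_ge_atTop 1]
      with n hlog hn p hp hp1 v
    have hn1 : (1 : ℝ) ≤ n := by exact_mod_cast hn
    have hp0 : 0 < p := (Real.rpow_pos_of_pos (by linarith) _).trans_le hp
    refine ⟨_, Finset.univ, fun g => {g}, 1, fun B hB => ?_, by simp, fun U hU => ?_⟩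
    · obtain ⟨t, ht, rfl⟩ := exists_placement_of_mem_bdH hB
      obtain ⟨h4, h5⟩ := Finset.mem_product.1 ht
      obtain ⟨g, hg⟩ : ∃ g, placedEdges H t = {g} := by
        rw [← Finset.card_eq_one, placedEdges, Finset.card_image_of_injective _
          (Sym2.map.injective (Finset.mem_filter.1 h4).2.1), Finset.card_erase_of_mem h5, he2]
      exact ⟨g, Finset.mem_univ _, by rw [hg]⟩
    · have hkey : (n : ℝ) ^ (1 : ℝ) ≤ (n : ℝ) ^ (Fintype.card V - 1) * p ^ 1 := by
        refine rpow_le_pow_mul_pow_of_rpow_le hn1 hp ?_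
        rw [hm, Nat.cast_sub (by omega)]
        push_cast
        linarith
      have hU' : (U.card : ℝ) ≤ ⌈24 * Real.log n⌉₊ := by
        rw [one_mul] at hU
        exact_mod_cast hU
      have hpow : (n : ℝ) ^ 2 * p ≤ (n : ℝ) ^ (Fintype.card V - 1) * p := by
        gcongr
        omega
      have hsum := sum_pow_card_singleton_sdiff_le hp0.le U
      rw [he2]
      simp only [pow_one, Real.rpow_one, Nat.add_one_sub_one] at hkey hlog ⊢
      set Q : ℝ := (n : ℝ) ^ (Fintype.card V - 1) * p with hQ
      have hQ0 : 0 ≤ Q := by positivity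
      have hM : 3 / 2 * ((Fintype.card V : ℝ) * (2 : ℕ) * n ^ (Fintype.card V - 1) * p) =
          3 * (Fintype.card V * Q) := by
        rw [hQ]
        push_cast
        ring
      rw [hM]
      nlinarith
  · have hm : 1 < twoDensity H := hbal.one_lt_twoDensity h3
    have hδ : 0 < 1 - 1 / twoDensity H := by
      rw [sub_pos, div_lt_one (by linarith)]
      exact hm
    filter_upwards [eventually_mul_ceil_log_pow_le (2 ^ (H.edgeFinset.card + 1) *
      (2 * H.edgeFinset.card : ℝ) ^ Fintype.card V) (Fintype.card V) hδ, eventually_ge_atTop 1]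
      with n hlog hn p hp hp1 v
    refine ⟨_, placements H n v, placedEdges H, H.edgeFinset.card,
      fun B hB => exists_placement_of_mem_bdH hB, fun t _ => ?_, fun U hU => ?_⟩
    · exact card_placedEdges_le H t
    · exact hbal.sum_pow_card_placedEdges_sdiff_le (hE ▸ h3) hn hp hlog v U hU
end

section
/- For every finite graph I with at least one edge and every integer d with 1 ≤ d ≤ Δ(I), there exists a subgraph Q ⊆ I with maximum degree Δ(Q) = d and with at least (d/(Δ(I)+1))·e(I) edges. -/
/-- The maximum degree of a graph on a finite vertex type. -/
noncomputable def maxDeg {α : Type*} [Fintype α] (G : SimpleGraph α) : ℕ :=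
  Finset.univ.sup fun v => Nat.card (G.neighborSet v)

open Finset

/-- The involutions `σ i`, `i ∈ K`, are pairwise edge-disjoint matchings: the partner of `x` in
colour `i` is `σ i x`, and `x` misses colour `i` when `σ i x = x`. -/
structure IsProperColoring {ι V : Type*} (K : Finset ι) (σ : ι → V → V) : Prop where
  invol : ∀ i ∈ K, ∀ x, σ i (σ i x) = x
  disj : ∀ i ∈ K, ∀ j ∈ K, i ≠ j → ∀ x, σ i x = σ j x → σ i x = x

/-- The orbit of a fixed point of `s` under two involutions `s`, `t` contains at most two fixed
points of `s`. -/
theorem exists_orbit_card_fixed_le_two {V : Type*} [Fintype V] [DecidableEq V] (s t : V → V)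
    (hs : ∀ x, s (s x) = x) (ht : ∀ x, t (t x) = x) (a : V) (ha : s a = a) :
    ∃ C : Finset V, a ∈ C ∧ (∀ x ∈ C, s x ∈ C) ∧ (∀ x ∈ C, t x ∈ C) ∧
      #{x ∈ C | s x = x} ≤ 2 := by
  classical
  let S : Equiv.Perm V := Function.Involutive.toPerm s hs
  let T : Equiv.Perm V := Function.Involutive.toPerm t ht
  have hSS : S * S = 1 := Equiv.ext hs
  have hTT : T * T = 1 := Equiv.ext ht
  have hSi : S⁻¹ = S := inv_eq_of_mul_eq_one_left hSS
  have hTi : T⁻¹ = T := inv_eq_of_mul_eq_one_left hTT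
  let P : Equiv.Perm V := T * S
  have hinv : P⁻¹ = S * T := by simp [P, mul_inv_rev, hSi, hTi]
  have hconj : ∀ n : ℤ, S * P ^ n = P ^ (-n) * S := by
    intro n
    have h1 : S * P * S⁻¹ = P⁻¹ := by
      rw [hinv, hSi]; simp only [P]; rw [← mul_assoc, mul_assoc, hSS, mul_one]
    have h2 : S * P ^ n * S⁻¹ = P ^ (-n) := by
      rw [← conj_zpow, h1, inv_zpow, zpow_neg]
    rw [← h2]; simp
  have hSn : ∀ n : ℤ, s ((P ^ n) a) = (P ^ (-n)) a := by
    intro n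
    have := congrArg (fun f : Equiv.Perm V => f a) (hconj n)
    simp only [Equiv.Perm.mul_apply] at this
    have h3 : S a = a := ha
    rw [h3] at this
    exact this
  have hTP : ∀ x, t x = P (s x) := by
    intro x
    change t x = t (s (s x))
    rw [hs]
  refine ⟨({x | P.SameCycle a x} : Finset V), by simp [Equiv.Perm.SameCycle.refl], ?_, ?_, ?_⟩
  · intro x hx
    simp only [mem_filter, mem_univ, true_and] at hx ⊢
    obtain ⟨n, rfl⟩ := hx
    exact ⟨-n, (hSn n).symm⟩
  · intro x hx
    simp only [mem_filter, mem_univ, true_and] at hx ⊢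
    obtain ⟨n, rfl⟩ := hx
    refine ⟨1 + -n, ?_⟩
    rw [hTP, hSn, zpow_add, zpow_one, Equiv.Perm.mul_apply]
  · set m := Function.minimalPeriod P a with hm
    have hmpos : 0 < m := Function.IsPeriodicPt.minimalPeriod_pos
      (orderOf_pos P) (by
        change (P^[orderOf P]) a = a
        rw [← Equiv.Perm.coe_pow, pow_orderOf_eq_one]; rfl)
    have hper : (P ^ m) a = a := by
      rw [Equiv.Perm.coe_pow]; exact Function.isPeriodicPt_minimalPeriod P a
    refine (card_le_card (t := {a, (P ^ (m / 2)) a}) ?_).trans card_le_two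
    intro x hx
    simp only [mem_filter, mem_univ, true_and] at hx
    obtain ⟨⟨n, rfl⟩, hfix⟩ := hx
    rw [hSn] at hfix
    have hperz : ∀ q : ℤ, (P ^ ((m : ℤ) * q)) a = a := by
      intro q
      rw [zpow_mul, zpow_natCast]
      exact Equiv.Perm.zpow_apply_eq_self_of_apply_eq_self hper q
    have hmod : (P ^ n) a = (P ^ (n % m)) a := by
      conv_lhs => rw [← Int.emod_add_mul_ediv n m, zpow_add, Equiv.Perm.mul_apply, hperz]
    obtain ⟨r, hr⟩ : ∃ r : ℕ, (r : ℤ) = n % m :=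
      ⟨(n % m).toNat, Int.toNat_of_nonneg (Int.emod_nonneg _ (by omega))⟩
    have hrm : r < m := by have := Int.emod_lt_of_pos n (b := m) (by omega); omega
    have h2n : (P ^ (n + n)) a = a := by
      rw [zpow_add, Equiv.Perm.mul_apply, ← hfix, ← Equiv.Perm.mul_apply, ← zpow_add]; simp
    have h2r : (P ^ (r + r)) a = a := by
      have h5 : n + n = ((r + r : ℕ) : ℤ) + m * (n / m + n / m) := by
        have := Int.emod_add_mul_ediv n m
        push_cast; rw [hr]; linarith
      rw [h5, zpow_add, Equiv.Perm.mul_apply, hperz, zpow_natCast] at h2n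
      exact h2n
    have hdvd : m ∣ r + r := by
      apply Function.IsPeriodicPt.minimalPeriod_dvd
      change (P^[r + r]) a = a
      rw [← Equiv.Perm.coe_pow]; exact h2r
    rw [hmod, ← hr, zpow_natCast]
    obtain ⟨q, hq⟩ := hdvd
    have hq2 : q < 2 := by
      by_contra h
      have : m * 2 ≤ m * q := Nat.mul_le_mul_left _ (by omega)
      omega
    interval_cases q
    · have : r = 0 := by omega
      simp [this]
    · have : r = m / 2 := by omega
      simp [this]

/-- A set closed under both involutions on which `X` outnumbers `Y` can be shrunk so that it also
meets `X` at most twice. -/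
theorem exists_closed_card_inter {V : Type*} [Fintype V] [DecidableEq V] (s t : V → V)
    (hs : ∀ x, s (s x) = x) (ht : ∀ x, t (t x) = x) (X Y : Finset V) (hX : ∀ x ∈ X, s x = x) :
    ∀ C : Finset V, (∀ x ∈ C, s x ∈ C) → (∀ x ∈ C, t x ∈ C) → #(Y ∩ C) < #(X ∩ C) →
      ∃ C' : Finset V, (∀ x ∈ C', s x ∈ C') ∧ (∀ x ∈ C', t x ∈ C') ∧
        #(Y ∩ C') < #(X ∩ C') ∧ #(X ∩ C') ≤ 2 := by
  intro C
  induction C using Finset.strongInduction with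
  | H C ih =>
    intro hsC htC hlt
    obtain ⟨a, haX⟩ : (X ∩ C).Nonempty := card_pos.1 (by omega)
    rw [mem_inter] at haX
    obtain ⟨O, haO, hsO, htO, hO⟩ := exists_orbit_card_fixed_le_two s t hs ht a (hX a haX.1)
    by_cases hgood : #(Y ∩ (C ∩ O)) < #(X ∩ (C ∩ O))
    · refine ⟨C ∩ O, by grind, by grind, hgood, le_trans (card_le_card ?_) hO⟩
      intro x hx
      grind
    · refine ih (C \ O) (by grind) (by grind) (by grind) ?_
      have e : ∀ Z : Finset V, #(Z ∩ C) = #(Z ∩ (C ∩ O)) + #(Z ∩ (C \ O)) := by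
        intro Z
        rw [← card_inter_add_card_sdiff (Z ∩ C) O]
        congr 2 <;> grind
      have := e X
      have := e Y
      omega

/-- Exchange the colours `i` and `j` at the vertices of `C`. -/
def kempeSwap {ι V : Type*} [DecidableEq ι] [DecidableEq V] (C : Finset V) (i j : ι) (x : V) :
    ι → ι :=
  fun k => if x ∈ C then Equiv.swap i j k else k

section kempeSwap

variable {ι V : Type*} [DecidableEq ι] [DecidableEq V] {K : Finset ι} {σ : ι → V → V}
  {C : Finset V} {i j : ι}

theorem kempeSwap_involutive (x : V) (k : ι) :
    kempeSwap C i j x (kempeSwap C i j x k) = k := by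
  by_cases h : x ∈ C <;> simp [kempeSwap, h]

theorem kempeSwap_mem (hi : i ∈ K) (hj : j ∈ K) (x : V) {k : ι} (hk : k ∈ K) :
    kempeSwap C i j x k ∈ K := by
  unfold kempeSwap
  rw [Equiv.swap_apply_def]
  grind

theorem IsProperColoring.kempeSwap (h : IsProperColoring K σ) (hi : i ∈ K) (hj : j ∈ K)
    (hiC : ∀ x ∈ C, σ i x ∈ C) (hjC : ∀ x ∈ C, σ j x ∈ C) :
    IsProperColoring K fun k x => σ (kempeSwap C i j x k) x := by
  constructor
  · intro k hk x
    have h1 := h.invol i hi x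
    have h2 := h.invol j hj x
    have h3 := h.invol k hk x
    have h4 := hiC (σ i x)
    have h5 := hjC (σ j x)
    have h6 := hiC x
    have h7 := hjC x
    simp only [_root_.kempeSwap, Equiv.swap_apply_def]
    grind
  · intro k hk l hl hkl x hx
    refine h.disj _ (kempeSwap_mem hi hj x hk) _ (kempeSwap_mem hi hj x hl) ?_ x hx
    intro he
    apply hkl
    rw [← kempeSwap_involutive (C := C) (i := i) (j := j) x k, he, kempeSwap_involutive]

theorem exists_kempeSwap_iff (hi : i ∈ K) (hj : j ∈ K) (x y : V) :
    (∃ k ∈ K, σ (kempeSwap C i j x k) x = y) ↔ ∃ k ∈ K, σ k x = y := by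
  constructor
  · rintro ⟨k, hk, rfl⟩
    exact ⟨_, kempeSwap_mem hi hj x hk, rfl⟩
  · rintro ⟨k, hk, rfl⟩
    exact ⟨_, kempeSwap_mem hi hj x hk, by rw [kempeSwap_involutive]⟩

end kempeSwap

/-- The vertices of `N` on whose list `A` the colour `i` appears. -/
def listedAt {ι V : Type*} [DecidableEq ι] (N : Finset V) (A : V → Finset ι) (i : ι) : Finset V :=
  {w ∈ N | i ∈ A w}

/-- Colours listed at the vertices of `N`, all of them missing there, can be distributed almost
evenly by Kempe changes. -/
theorem exists_balanced {ι V : Type*} [DecidableEq ι] [Fintype V] [DecidableEq V] (K : Finset ι)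
    (N : Finset V) :
    ∀ (m : ℕ) (σ : ι → V → V) (A : V → Finset ι), ∑ i ∈ K, #(listedAt N A i) ^ 2 = m →
      IsProperColoring K σ → (∀ w ∈ N, A w ⊆ K) → (∀ w ∈ N, ∀ i ∈ A w, σ i w = w) →
      ∃ (σ' : ι → V → V) (A' : V → Finset ι), IsProperColoring K σ' ∧
        (∀ x y, (∃ i ∈ K, σ' i x = y) ↔ ∃ i ∈ K, σ i x = y) ∧
        (∀ v, (∀ i ∈ K, σ i v = v) → ∀ i ∈ K, σ' i v = v) ∧
        (∀ w, #(A' w) = #(A w)) ∧ (∀ w ∈ N, A' w ⊆ K) ∧ (∀ w ∈ N, ∀ i ∈ A' w, σ' i w = w) ∧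
        ∀ i ∈ K, ∀ j ∈ K, #(listedAt N A' i) ≤ #(listedAt N A' j) + 2 := by
  intro m
  induction m using Nat.strong_induction_on with
  | _ m ih =>
    intro σ A hm hσ hAK hA
    by_cases hb : ∀ i ∈ K, ∀ j ∈ K, #(listedAt N A i) ≤ #(listedAt N A j) + 2
    · exact ⟨σ, A, hσ, fun _ _ => Iff.rfl, fun _ h => h, fun _ => rfl, hAK, hA, hb⟩
    push Not at hb
    obtain ⟨i, hi, j, hj, hlt⟩ := hb
    have hij : i ≠ j := by rintro rfl; omega
    obtain ⟨C, hiC, hjC, hC, hC2⟩ := exists_closed_card_inter (σ i) (σ j) (hσ.invol i hi)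
      (hσ.invol j hj) (listedAt N A i) (listedAt N A j)
      (fun x hx => by simp only [listedAt, mem_filter] at hx; exact hA x hx.1 i hx.2) univ
      (by simp) (by simp) (by simp only [inter_univ]; omega)
    let A' : V → Finset ι := fun w => (A w).image (kempeSwap C i j w)
    have hinj : ∀ w, Function.Injective (kempeSwap C i j w) := fun w =>
      Function.Involutive.injective (kempeSwap_involutive w)
    have hmem : ∀ w k, k ∈ A' w ↔ kempeSwap C i j w k ∈ A w := by
      intro w k
      rw [← (hinj w).mem_finset_image (s := A w), kempeSwap_involutive]
    have hA'K : ∀ w ∈ N, A' w ⊆ K := by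
      intro w hw k hk
      rw [← kempeSwap_involutive (C := C) (i := i) (j := j) w k]
      exact kempeSwap_mem hi hj w (hAK w hw ((hmem w k).1 hk))
    have hsplit : ∀ Z : Finset V, #Z = #(Z ∩ C) + #(Z \ C) := fun Z =>
      (card_inter_add_card_sdiff Z C).symm
    have hXi : #(listedAt N A' i) = #(listedAt N A j ∩ C) + #(listedAt N A i \ C) := by
      rw [hsplit (listedAt N A' i)]
      congr 2 <;> ext w <;> simp only [listedAt, mem_inter, mem_sdiff, mem_filter, hmem, kempeSwap]
        <;> by_cases hw : w ∈ C <;> simp [hw]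
    have hXj : #(listedAt N A' j) = #(listedAt N A i ∩ C) + #(listedAt N A j \ C) := by
      rw [hsplit (listedAt N A' j)]
      congr 2 <;> ext w <;> simp only [listedAt, mem_inter, mem_sdiff, mem_filter, hmem, kempeSwap]
        <;> by_cases hw : w ∈ C <;> simp [hw]
    have hXk : ∀ k ∈ (K.erase i).erase j, #(listedAt N A' k) ^ 2 = #(listedAt N A k) ^ 2 := by
      intro k hk
      simp only [mem_erase] at hk
      congr 2
      ext w
      simp [listedAt, hmem, kempeSwap, Equiv.swap_apply_of_ne_of_ne hk.2.1 hk.1]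
    have hdec : ∑ k ∈ K, #(listedAt N A' k) ^ 2 < m := by
      have hj' : j ∈ K.erase i := mem_erase.2 ⟨hij.symm, hj⟩
      rw [← hm, ← add_sum_erase K _ hi, ← add_sum_erase K _ hi, ← add_sum_erase _ _ hj',
        ← add_sum_erase _ _ hj', sum_congr rfl hXk, hXi, hXj]
      have h1 := hsplit (listedAt N A i)
      have h2 := hsplit (listedAt N A j)
      generalize #(listedAt N A i) = a at *
      generalize #(listedAt N A j) = b at *
      generalize #(listedAt N A i ∩ C) = p at *
      generalize #(listedAt N A j ∩ C) = q at *
      generalize #(listedAt N A i \ C) = r at *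
      generalize #(listedAt N A j \ C) = s at *
      subst h1 h2
      obtain ⟨δ, rfl⟩ := Nat.exists_eq_add_of_lt hC
      obtain ⟨f, rfl⟩ : ∃ f, r = s + 1 + f := ⟨r - s - 1, by omega⟩
      nlinarith
    obtain ⟨σ'', A'', h1, h2, h3, h4, h5⟩ := ih _ hdec _ A' rfl (hσ.kempeSwap hi hj hiC hjC) hA'K
      (fun w hw k hk => hA w hw _ ((hmem w k).1 hk))
    refine ⟨σ'', A'', h1, fun x y => (h2 x y).trans (exists_kempeSwap_iff hi hj x y),
      fun v hv => h3 v fun k hk => hv _ (kempeSwap_mem hi hj v hk), fun w => ?_, h5⟩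
    rw [h4, card_image_of_injective _ (hinj w)]

theorem exists_listedAt_card_eq_one {ι V : Type*} [DecidableEq ι] (K : Finset ι)
    (N : Finset V) (A : V → Finset ι) (w₀ : V) (hw₀ : w₀ ∈ N) (hNK : #N ≤ #K)
    (hAK : ∀ w ∈ N, A w ⊆ K) (h1 : #(A w₀) = 1) (h2 : ∀ w ∈ N, w ≠ w₀ → #(A w) = 2)
    (hb : ∀ i ∈ K, ∀ j ∈ K, #(listedAt N A i) ≤ #(listedAt N A j) + 2) :
    ∃ i ∈ K, #(listedAt N A i) = 1 := by
  classical
  have hsum : ∑ i ∈ K, #(listedAt N A i) = ∑ w ∈ N, #(A w) := by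
    have := sum_card_bipartiteAbove_eq_sum_card_bipartiteBelow (s := N) (t := K)
      (fun w i => i ∈ A w)
    calc ∑ i ∈ K, #(listedAt N A i) = ∑ w ∈ N, #{i ∈ K | i ∈ A w} := this.symm
      _ = ∑ w ∈ N, #(A w) := sum_congr rfl fun w hw => by
        rw [filter_mem_eq_inter, inter_eq_right.2 (hAK w hw)]
  have hsum2 : ∑ w ∈ N, #(A w) + 1 = 2 * #N := by
    rw [← add_sum_erase N _ hw₀, h1, sum_congr rfl (g := fun _ => 2)
      (fun w hw => h2 w (mem_of_mem_erase hw) (ne_of_mem_erase hw)), sum_const,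
      card_erase_of_mem hw₀]
    have := card_pos.2 ⟨w₀, hw₀⟩
    simp only [smul_eq_mul]
    omega
  by_contra! hne
  obtain ⟨j, hj, hj1⟩ : ∃ j ∈ K, #(listedAt N A j) < 2 := by
    by_contra! hge
    have := card_nsmul_le_sum K (fun i => #(listedAt N A i)) 2 hge
    simp only [smul_eq_mul] at this
    omega
  have heven : Even (∑ i ∈ K, #(listedAt N A i)) := by
    refine even_sum _ fun i hi => ?_
    have := hb i hi j hj
    have := hne i hi
    have := hne j hj
    obtain h | h : #(listedAt N A i) = 0 ∨ #(listedAt N A i) = 2 := by omega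
    all_goals simp [h]
  rw [hsum] at heven
  obtain ⟨r, hr⟩ := heven
  omega

/-- Adding the edge `vu` in the colour `i`. -/
theorem IsProperColoring.insert_edge {ι V : Type*} [DecidableEq ι] [DecidableEq V]
    {K : Finset ι} {i : ι} {σ τ : ι → V → V} {v u : V} {N : Finset V} (hi : i ∈ K)
    (hvN : v ∉ N) (huN : u ∈ N) (hσ : IsProperColoring K σ) (hv : ∀ k ∈ K, σ k v = v)
    (hu : σ i u = u) (hτ : IsProperColoring (K.erase i) τ)
    (hτσ : ∀ x y, x ≠ y → ((∃ k ∈ K.erase i, τ k x = y) ↔ (∃ k ∈ K.erase i, σ k x = y) ∨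
      (x = v ∧ y ∈ N.erase u) ∨ (y = v ∧ x ∈ N.erase u))) :
    ∃ ρ : ι → V → V, IsProperColoring K ρ ∧
      ∀ x y, x ≠ y → ((∃ k ∈ K, ρ k x = y) ↔ (∃ k ∈ K, σ k x = y) ∨
        (x = v ∧ y ∈ N) ∨ (y = v ∧ x ∈ N)) := by
  have huv : u ≠ v := by rintro rfl; exact hvN huN
  let s : V → V := fun x => if x = v then u else if x = u then v else σ i x
  have hs : ∀ x, s (s x) = x := by
    intro x
    have := hσ.invol i hi
    have := hv i hi
    simp only [s]
    grind
  have hsτ : ∀ k ∈ K, k ≠ i → ∀ x, s x = τ k x → s x = x := by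
    intro k hk hki x hx
    by_contra hne
    have h1 := (hτσ x (s x) (Ne.symm hne)).1 ⟨k, mem_erase.2 ⟨hki, hk⟩, hx.symm⟩
    rcases h1 with ⟨l, hl, hl'⟩ | ⟨rfl, h⟩ | ⟨h, h'⟩
    · have h2 := hσ.disj l (mem_of_mem_erase hl) i hi (ne_of_mem_erase hl) x
      have h3 := hv l (mem_of_mem_erase hl)
      have h4 := hσ.invol l (mem_of_mem_erase hl)
      simp only [s] at *
      grind
    · simp [s] at h
    · have h2 := hσ.invol i hi x
      have h3 := hv i hi
      simp only [s] at *
      grind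
  refine ⟨Function.update τ i s, ⟨?_, ?_⟩, ?_⟩
  · intro k hk x
    rcases eq_or_ne k i with rfl | hki
    · simpa using hs x
    · simpa [hki] using hτ.invol k (mem_erase.2 ⟨hki, hk⟩) x
  · intro k hk l hl hkl x
    rcases eq_or_ne k i with rfl | hki
    · simpa [hkl.symm] using hsτ l hl hkl.symm x
    · rcases eq_or_ne l i with rfl | hli
      · intro h
        simp only [ne_eq, hki, not_false_eq_true, Function.update_of_ne,
          Function.update_self] at h ⊢
        rw [h]
        exact hsτ k hk hki x h.symm
      · simpa [hki, hli] using hτ.disj k (mem_erase.2 ⟨hki, hk⟩) l (mem_erase.2 ⟨hli, hl⟩) hkl x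
  · intro x y hxy
    have e : ∀ ρ : ι → V → V, (∃ k ∈ K, ρ k x = y) ↔ ρ i x = y ∨ ∃ k ∈ K.erase i, ρ k x = y := by
      intro ρ
      conv_lhs => rw [← insert_erase hi]
      simp only [exists_mem_insert]
    have e2 : (∃ k ∈ K.erase i, Function.update τ i s k x = y) ↔ ∃ k ∈ K.erase i, τ k x = y := by
      refine exists_congr fun k => and_congr_right fun hk => ?_
      rw [Function.update_of_ne (ne_of_mem_erase hk)]
    rw [e, e2, Function.update_self, hτσ x y hxy, e σ]
    have := hv i hi
    simp only [s]
    grind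

/-- If every vertex of `N` has two missing colours, with one exception having at least one, then
a vertex `v` isolated in the colouring can be joined to all of `N`. -/
theorem IsProperColoring.exists_join {ι V : Type*} [DecidableEq ι] [Fintype V] [DecidableEq V]
    (v : V) :
    ∀ (n : ℕ) (K : Finset ι) (σ : ι → V → V) (N : Finset V) (A : V → Finset ι) (w₀ : V),
      #N = n → #N ≤ #K → v ∉ N → IsProperColoring K σ → (∀ i ∈ K, σ i v = v) →
      (∀ w ∈ N, 1 ≤ #(A w)) → (∀ w ∈ N, w ≠ w₀ → 2 ≤ #(A w)) →
      (∀ w ∈ N, A w ⊆ K) → (∀ w ∈ N, ∀ i ∈ A w, σ i w = w) →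
      ∃ τ : ι → V → V, IsProperColoring K τ ∧
        ∀ x y, x ≠ y → ((∃ i ∈ K, τ i x = y) ↔ (∃ i ∈ K, σ i x = y) ∨
          (x = v ∧ y ∈ N) ∨ (y = v ∧ x ∈ N)) := by
  intro n
  induction n with
  | zero =>
    intro K σ N A w₀ hN hNK hvN hσ hv h1 h2 hAK hA
    rw [card_eq_zero] at hN
    subst hN
    exact ⟨σ, hσ, by simp⟩
  | succ n ih =>
    intro K σ N A w₀ hN hNK hvN hσ hv h1 h2 hAK hA
    obtain ⟨w₁, hw₁, hw₁'⟩ : ∃ w₁ ∈ N, ∀ w ∈ N, w ≠ w₁ → 2 ≤ #(A w) := by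
      by_cases h : w₀ ∈ N
      · exact ⟨w₀, h, h2⟩
      · obtain ⟨w₁, hw₁⟩ : N.Nonempty := card_pos.1 (by omega)
        exact ⟨w₁, hw₁, fun w hw _ => h2 w hw (by rintro rfl; exact h hw)⟩
    have hB : ∀ w, ∃ B : Finset ι, w ∈ N → B ⊆ A w ∧ #B = if w = w₁ then 1 else 2 := by
      intro w
      by_cases hw : w ∈ N
      · obtain ⟨B, hB⟩ := exists_subset_card_eq (s := A w) (n := if w = w₁ then 1 else 2) (by
          split_ifs with h
          · exact h1 w hw
          · exact hw₁' w hw h)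
        exact ⟨B, fun _ => hB⟩
      · exact ⟨∅, fun h => absurd h hw⟩
    choose B hB using hB
    obtain ⟨σ', A', hσ', hedge, hfix, hcard, hA'K, hA', hbal⟩ := exists_balanced K N _ σ B rfl hσ
      (fun w hw => (hB w hw).1.trans (hAK w hw)) (fun w hw i hi => hA w hw i ((hB w hw).1 hi))
    have hc : ∀ w ∈ N, #(A' w) = if w = w₁ then 1 else 2 := fun w hw => by
      rw [hcard, (hB w hw).2]
    obtain ⟨i, hi, hi1⟩ := exists_listedAt_card_eq_one K N A' w₁ hw₁ hNK hA'K
      (by simpa using hc w₁ hw₁) (fun w hw h => by simpa [h] using hc w hw) hbal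
    obtain ⟨u, hu⟩ := card_eq_one.1 hi1
    have hu' : ∀ w, w ∈ N ∧ i ∈ A' w ↔ w = u := by
      intro w
      rw [← mem_singleton, ← hu, listedAt, mem_filter]
    obtain ⟨huN, hiu⟩ := (hu' u).2 rfl
    have hsub : IsProperColoring (K.erase i) σ' :=
      ⟨fun k hk => hσ'.invol k (mem_of_mem_erase hk), fun k hk l hl =>
        hσ'.disj k (mem_of_mem_erase hk) l (mem_of_mem_erase hl)⟩
    obtain ⟨τ, hτ, hτσ⟩ := ih (K.erase i) σ' (N.erase u) A' w₁
      (by rw [card_erase_of_mem huN]; omega)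
      (by rw [card_erase_of_mem huN, card_erase_of_mem hi]; omega)
      (fun h => hvN (mem_of_mem_erase h)) hsub
      (fun k hk => hfix v hv k (mem_of_mem_erase hk))
      (fun w hw => by rw [hc w (mem_of_mem_erase hw)]; split_ifs <;> omega)
      (fun w hw h => by rw [hc w (mem_of_mem_erase hw), if_neg h])
      (fun w hw k hk => mem_erase.2 ⟨by
        rintro rfl
        exact ne_of_mem_erase hw ((hu' w).1 ⟨mem_of_mem_erase hw, hk⟩),
        hA'K w (mem_of_mem_erase hw) hk⟩)
      (fun w hw => hA' w (mem_of_mem_erase hw))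
    obtain ⟨ρ, hρ, hρσ⟩ := hσ'.insert_edge hi hvN huN (hfix v hv) (hA' u huN i hiu) hτ hτσ
    exact ⟨ρ, hρ, fun x y hxy => by rw [hρσ x y hxy, hedge]⟩

/-- **Vizing's theorem**: if all degrees are at most `D`, then `D + 1` colours suffice. -/
theorem exists_properColoring {V : Type*} [Fintype V] [DecidableEq V] (G : SimpleGraph V)
    [DecidableRel G.Adj] (D : ℕ) (hD : ∀ v, G.degree v ≤ D) (S : Finset V) :
    ∃ σ : Fin (D + 1) → V → V, IsProperColoring univ σ ∧
      ∀ x y, x ≠ y → ((∃ i, σ i x = y) ↔ G.Adj x y ∧ x ∈ S ∧ y ∈ S) := by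
  induction S using Finset.induction_on with
  | empty => exact ⟨fun _ x => x, ⟨by simp, by simp⟩, by simp⟩
  | insert v S hvS ih =>
    obtain ⟨σ, hσ, hσG⟩ := ih
    let N : Finset V := {w ∈ S | G.Adj v w}
    have hNdeg : #N ≤ D :=
      (card_le_card fun w hw => by simpa [N] using (mem_filter.1 hw).2).trans (hD v)
    have hfix : ∀ i, σ i v = v := by
      intro i
      by_contra h
      exact hvS ((hσG v (σ i v) (Ne.symm h)).1 ⟨i, rfl⟩).2.1
    have hmiss : ∀ w ∈ N, 2 ≤ #{i | σ i w = w} := by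
      intro w hw
      have hGw : G.Adj w v := ((mem_filter.1 hw).2).symm
      have hused : #{i | ¬ σ i w = w} ≤ #((G.neighborFinset w).erase v) := by
        refine card_le_card_of_injOn (fun i => σ i w) ?_ ?_
        · intro i hi
          have hne : σ i w ≠ w := by simpa using hi
          obtain ⟨h1, -, h3⟩ := (hσG w (σ i w) hne.symm).1 ⟨i, rfl⟩
          simp only [coe_erase, Set.mem_sdiff, mem_coe, SimpleGraph.mem_neighborFinset,
            Set.mem_singleton_iff]
          exact ⟨h1, fun h => hvS (h ▸ h3)⟩
        · intro i hi j hj hij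
          have hne : σ i w ≠ w := by simpa using hi
          by_contra h
          exact hne (hσ.disj i (mem_univ i) j (mem_univ j) h w hij)
      rw [card_erase_of_mem (by simpa using hGw), SimpleGraph.card_neighborFinset_eq_degree]
        at hused
      have h1 := card_filter_add_card_filter_not (s := (univ : Finset (Fin (D + 1))))
        (fun i => σ i w = w)
      have h2 : 0 < G.degree w := (G.degree_pos_iff_exists_adj w).2 ⟨v, hGw⟩
      have h3 := hD w
      simp only [card_univ, Fintype.card_fin] at h1
      omega
    obtain ⟨τ, hτ, hτσ⟩ := IsProperColoring.exists_join v #N univ σ N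
      (fun w => {i | σ i w = w}) v rfl (by simp; omega) (by simp [N, hvS]) hσ (fun i _ => hfix i)
      (fun w hw => (by omega : 1 ≤ 2).trans (hmiss w hw)) (fun w hw _ => hmiss w hw)
      (by simp) (by simp)
    refine ⟨τ, hτ, fun x y hxy => ?_⟩
    have := hτσ x y hxy
    simp only [mem_univ, true_and] at this
    rw [this, hσG x y hxy]
    have := G.adj_comm x y
    have := G.ne_of_adj (a := x) (b := y)
    simp only [N]
    grind

/-- Some `d` elements carry at least the average share of the total weight. -/
theorem exists_subset_card_mul_sum_le {ι : Type*} [DecidableEq ι] (p : ι → ℕ) (d : ℕ)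
    (K : Finset ι) (hd : d ≤ #K) :
    ∃ D ⊆ K, #D = d ∧ d * ∑ i ∈ K, p i ≤ #K * ∑ i ∈ D, p i := by
  induction K using Finset.strongInduction with
  | H K ih =>
    rcases hd.eq_or_lt with rfl | hlt
    · exact ⟨K, Subset.rfl, rfl, le_rfl⟩
    obtain ⟨a, ha, hmin⟩ := exists_min_image K p (card_pos.1 (by omega))
    have hcard := card_erase_add_one ha
    obtain ⟨D, hDK, hD, hle⟩ := ih (K.erase a) (erase_ssubset ha) (by omega)
    refine ⟨D, hDK.trans (erase_subset a K), hD, ?_⟩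
    have h1 : #(K.erase a) * p a ≤ ∑ i ∈ K.erase a, p i := by
      simpa using card_nsmul_le_sum (K.erase a) p (p a) fun i hi => hmin i (mem_of_mem_erase hi)
    rw [← add_sum_erase K p ha, ← hcard]
    generalize #(K.erase a) = m at *
    generalize ∑ i ∈ K.erase a, p i = T at *
    generalize ∑ i ∈ D, p i = U at *
    rcases Nat.eq_zero_or_pos m with rfl | hm
    · have : d = 0 := by omega
      simp [this]
    refine Nat.le_of_mul_le_mul_left ?_ hm
    calc m * (d * (p a + T)) = d * (m * p a) + m * d * T := by ring
      _ ≤ d * T + m * d * T := by gcongr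
      _ = (m + 1) * (d * T) := by ring
      _ ≤ (m + 1) * (m * U) := by gcongr
      _ = m * ((m + 1) * U) := by ring

theorem IsProperColoring.degree_eq {ι V : Type*} [Fintype V] [DecidableEq V]
    {D : Finset ι} {σ : ι → V → V} (hσ : IsProperColoring D σ) (Q : SimpleGraph V)
    [DecidableRel Q.Adj] (hQ : ∀ x y, Q.Adj x y ↔ x ≠ y ∧ ∃ i ∈ D, σ i x = y) (x : V) :
    Q.degree x = #{i ∈ D | σ i x ≠ x} := by
  rw [← Q.card_neighborFinset_eq_degree]
  symm
  refine card_bij (fun i _ => σ i x) ?_ ?_ ?_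
  · intro i hi
    rw [mem_filter] at hi
    exact (Q.mem_neighborFinset _ _).2 ((hQ _ _).2 ⟨hi.2.symm, i, hi.1, rfl⟩)
  · intro i hi j hj hij
    rw [mem_filter] at hi hj
    by_contra h
    exact hi.2 (hσ.disj i hi.1 j hj.1 h x hij)
  · intro y hy
    obtain ⟨hne, i, hi, rfl⟩ := (hQ _ _).1 ((Q.mem_neighborFinset _ _).1 hy)
    exact ⟨i, mem_filter.2 ⟨hi, hne.symm⟩, rfl⟩

theorem IsProperColoring.two_mul_card_edges {ι V : Type*} [Fintype V] [DecidableEq V]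
    {D : Finset ι} {σ : ι → V → V} (hσ : IsProperColoring D σ) (Q : SimpleGraph V)
    (hQ : ∀ x y, Q.Adj x y ↔ x ≠ y ∧ ∃ i ∈ D, σ i x = y) :
    2 * Nat.card Q.edgeSet = ∑ i ∈ D, #{x | σ i x ≠ x} := by
  classical
  rw [Nat.card_eq_fintype_card, ← Q.edgeFinset_card, ← Q.sum_degrees_eq_twice_card_edges,
    sum_congr rfl fun x _ => hσ.degree_eq Q hQ x]
  exact sum_card_bipartiteAbove_eq_sum_card_bipartiteBelow fun x i => σ i x ≠ x

theorem maxDeg_le_iff {V : Type*} [Fintype V] (G : SimpleGraph V) [DecidableRel G.Adj] (d : ℕ) :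
    maxDeg G ≤ d ↔ ∀ v, G.degree v ≤ d := by
  simp only [maxDeg, Finset.sup_le_iff, mem_univ, true_imp_iff, Nat.card_eq_fintype_card,
    SimpleGraph.card_neighborSet_eq_degree]

theorem maxDeg_sup_edge_le {V : Type*} [Fintype V] (G : SimpleGraph V) (x y : V) :
    maxDeg (G ⊔ SimpleGraph.edge x y) ≤ maxDeg G + 1 := by
  classical
  rw [maxDeg_le_iff]
  intro z
  have hz := (maxDeg_le_iff G _).1 le_rfl z
  rw [← SimpleGraph.card_neighborFinset_eq_degree] at hz ⊢
  refine (card_le_card (t := insert (if z = x then y else x) (G.neighborFinset z)) ?_).trans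
    ((card_insert_le _ _).trans (by omega))
  intro w hw
  simp only [SimpleGraph.mem_neighborFinset, SimpleGraph.sup_adj, SimpleGraph.edge_adj,
    mem_insert] at hw ⊢
  grind

/-- A subgraph of maximum degree at most `d` extends to one of maximum degree exactly `d`. -/
theorem exists_le_maxDeg_eq {V : Type*} [Fintype V] (I Q₀ : SimpleGraph V) (d : ℕ)
    (hd : d ≤ maxDeg I) (hQ₀ : Q₀ ≤ I) (hQ₀d : maxDeg Q₀ ≤ d) :
    ∃ Q, Q₀ ≤ Q ∧ Q ≤ I ∧ maxDeg Q = d := by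
  obtain ⟨Q, hQ₀Q, hQ⟩ :=
    (Set.toFinite {Q : SimpleGraph V | Q ≤ I ∧ maxDeg Q ≤ d}).exists_le_maximal (a := Q₀) ⟨hQ₀, hQ₀d⟩
  refine ⟨Q, hQ₀Q, hQ.prop.1, hQ.prop.2.antisymm ?_⟩
  by_contra! hlt
  have hnle : ¬ I ≤ Q := fun h => by
    rw [le_antisymm hQ.prop.1 h] at hlt
    omega
  obtain ⟨x, y, hI, hQxy⟩ : ∃ x y, I.Adj x y ∧ ¬ Q.Adj x y := by
    by_contra! h
    exact hnle fun x y => h x y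
  have hmem : Q ⊔ SimpleGraph.edge x y ≤ I ∧ maxDeg (Q ⊔ SimpleGraph.edge x y) ≤ d :=
    ⟨sup_le hQ.prop.1 ((SimpleGraph.edge_le_iff _).2 (Or.inr hI)),
      (maxDeg_sup_edge_le Q x y).trans hlt⟩
  have := hQ.le_of_ge hmem le_sup_left
  exact hQxy (this (Or.inr ((SimpleGraph.edge_adj ..).2 ⟨Or.inl ⟨rfl, rfl⟩, hI.ne⟩)))

theorem stmt10 {α : Type} [Fintype α] (I : SimpleGraph α) (hI : 1 ≤ Nat.card I.edgeSet)
    (d : ℕ) (hd1 : 1 ≤ d) (hd2 : d ≤ maxDeg I) :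
    ∃ Q : SimpleGraph α, Q ≤ I ∧ maxDeg Q = d ∧
      ((d : ℝ) / ((maxDeg I : ℝ) + 1)) * (Nat.card I.edgeSet : ℝ) ≤ (Nat.card Q.edgeSet : ℝ) := by
  classical
  obtain ⟨σ, hσ, hσI⟩ := exists_properColoring I (maxDeg I) ((maxDeg_le_iff I _).1 le_rfl) univ
  have hIσ : ∀ x y, I.Adj x y ↔ x ≠ y ∧ ∃ i ∈ univ, σ i x = y := by
    intro x y
    have h := hσI x y
    simp only [mem_univ, true_and, and_true] at h ⊢
    exact ⟨fun hxy => ⟨hxy.ne, (h hxy.ne).2 hxy⟩, fun hxy => (h hxy.1).1 hxy.2⟩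
  obtain ⟨D, -, hD, hle⟩ := exists_subset_card_mul_sum_le (fun i => #{x | σ i x ≠ x}) d univ
    (by simp; omega)
  have hσD : IsProperColoring D σ :=
    ⟨fun i _ => hσ.invol i (mem_univ i), fun i _ j _ => hσ.disj i (mem_univ i) j (mem_univ j)⟩
  let Q₀ : SimpleGraph α :=
    { Adj := fun x y => x ≠ y ∧ ∃ i ∈ D, σ i x = y
      symm := ⟨by
        rintro x y ⟨hne, i, hi, rfl⟩
        exact ⟨hne.symm, i, hi, hσD.invol i hi x⟩⟩
      loopless := ⟨fun x hx => hx.1 rfl⟩ }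
  have hQ₀ : ∀ x y, Q₀.Adj x y ↔ x ≠ y ∧ ∃ i ∈ D, σ i x = y := fun _ _ => Iff.rfl
  obtain ⟨Q, hQ₀Q, hQI, hQd⟩ := exists_le_maxDeg_eq I Q₀ d hd2
    (fun x y h => (hIσ x y).2 ⟨h.1, h.2.imp fun i hi => ⟨mem_univ i, hi.2⟩⟩)
    ((maxDeg_le_iff Q₀ d).2 fun x => by
      rw [hσD.degree_eq Q₀ hQ₀, ← hD]
      exact card_filter_le _ _)
  refine ⟨Q, hQI, hQd, ?_⟩
  have hcard : Nat.card Q₀.edgeSet ≤ Nat.card Q.edgeSet :=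
    Nat.card_mono (Set.toFinite _) (SimpleGraph.edgeSet_mono hQ₀Q)
  rw [← hσ.two_mul_card_edges I hIσ, ← hσD.two_mul_card_edges Q₀ hQ₀, card_univ,
    Fintype.card_fin] at hle
  have hfin : d * Nat.card I.edgeSet ≤ Nat.card Q.edgeSet * (maxDeg I + 1) := by
    nlinarith
  rw [div_mul_eq_mul_div, div_le_iff₀ (by positivity)]
  exact_mod_cast hfin
end

section
/- Let H be an edge-critical graph with χ(H) = r+1 ≥ 3 and v_H vertices. For integers m ≥ v_H, let K_r(m)^+ denote the complete balanced r-partite graph with all parts of size m together with one additional edge inside one of its parts, and let N(H,G) denote the number of subgraphs of G isomorphic to H. Then the sequence N(H, K_r(m)^+)/m^{v_H−2} converges as m → ∞, and its limit π_H is strictly positive. -/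
open Filter Topology

/-- `H` is edge-critical: deleting some edge decreases the chromatic number. -/
def EdgeCritical {α : Type*} (H : SimpleGraph α) : Prop :=
  ∃ e ∈ H.edgeSet, (H.deleteEdges {e}).chromaticNumber < H.chromaticNumber

/-- The number of subgraphs of `G` isomorphic to `H`. -/
noncomputable def copyCount {α β : Type*} (H : SimpleGraph α) (G : SimpleGraph β) : ℕ :=
  Nat.card {F : G.Subgraph // Nonempty (H ≃g F.coe)}

/-- The complete balanced `r`-partite graph with parts of size `m`, together with one
additional edge inside the first part (joining its first two vertices). -/
def KrmPlus (r m : ℕ) : SimpleGraph (Fin r × Fin m) :=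
  SimpleGraph.fromRel fun u v =>
    u.1 ≠ v.1 ∨ (u.1.val = 0 ∧ v.1.val = 0 ∧ u.2.val = 0 ∧ v.2.val = 1)

namespace SimpleGraph

variable {V W : Type*}

/-- Copies of `H` in `G` are pairs of a subgraph isomorphic to `H` and an isomorphism onto it. -/
noncomputable def copyEquivSigma (H : SimpleGraph V) (G : SimpleGraph W) :
    Copy H G ≃ Σ F : {F : G.Subgraph // Nonempty (H ≃g F.coe)}, (H ≃g F.1.coe) := by
  refine (Equiv.ofBijective (fun s => s.1.1.coeCopy.comp s.2.toCopy) ⟨?_, fun f => ?_⟩).symm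
  · rintro ⟨⟨F, hF⟩, e⟩ ⟨⟨F', hF'⟩, e'⟩ h
    have hval : ∀ v, (e v : W) = e' v := fun v => DFunLike.congr_fun h v
    have hle : ∀ {F F' : G.Subgraph} (e : H ≃g F.coe) (e' : H ≃g F'.coe),
        (∀ v, (e v : W) = e' v) → F ≤ F' := by
      intro F F' e e' hval
      have key : ∀ x (hx : x ∈ F.verts), ((e' (e.symm ⟨x, hx⟩) : F'.verts) : W) = x := by
        intro x hx
        rw [← hval, e.apply_symm_apply]
      refine ⟨fun x hx => ?_, fun x y hxy => ?_⟩
      · rw [← key x hx]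
        exact (e' _).2
      · have h1 : H.Adj (e.symm ⟨x, hxy.fst_mem⟩) (e.symm ⟨y, hxy.snd_mem⟩) :=
          e.symm.map_adj_iff.2 hxy
        have h2 : F'.Adj (e' (e.symm ⟨x, hxy.fst_mem⟩)) (e' (e.symm ⟨y, hxy.snd_mem⟩)) :=
          e'.map_adj_iff.2 h1
        rwa [key, key] at h2
    obtain rfl : F = F' := le_antisymm (hle e e' hval) (hle e' e fun v => (hval v).symm)
    obtain rfl : e = e' := RelIso.ext fun v => Subtype.ext (hval v)
    rfl
  · refine ⟨⟨⟨f.toSubgraph, ⟨f.isoToSubgraph⟩⟩, f.isoToSubgraph⟩, Copy.ext fun v => ?_⟩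
    rfl

/-- Labelled copies are counted by unlabelled copies times automorphisms. -/
theorem card_copy_eq_copyCount_mul [Finite V] [Finite W] (H : SimpleGraph V)
    (G : SimpleGraph W) :
    Nat.card (Copy H G) = _root_.copyCount H G * Nat.card (H ≃g H) := by
  classical
  have := Fintype.ofFinite {F : G.Subgraph // Nonempty (H ≃g F.coe)}
  have hfin : ∀ F : G.Subgraph, Finite (H ≃g F.coe) := fun F =>
    Finite.of_injective _ (RelIso.toEquiv_injective (r := H.Adj) (s := F.coe.Adj))
  have hcard : ∀ F : {F : G.Subgraph // Nonempty (H ≃g F.coe)},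
      Nat.card (H ≃g F.1.coe) = Nat.card (H ≃g H) := by
    rintro ⟨F, ⟨e⟩⟩
    exact Nat.card_congr
      ⟨fun e' => e'.trans e.symm, fun e' => e'.trans e,
        fun _ => RelIso.ext fun _ => by simp, fun _ => RelIso.ext fun _ => by simp⟩
  rw [Nat.card_congr (copyEquivSigma H G), Nat.card_sigma, Finset.sum_congr rfl fun F _ => hcard F,
    Finset.sum_const, smul_eq_mul, Finset.card_univ, ← Nat.card_eq_fintype_card,
    _root_.copyCount]

/-- The triples `(c, a, b)` where `ab` is an edge of `H` and `c` is a colouring of `H - ab` by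
`r` colours giving the first colour to both `a` and `b`. -/
abbrev DefectColoring (H : SimpleGraph V) (r : ℕ) :=
  {t : (V → Fin r) × V × V // H.Adj t.2.1 t.2.2 ∧ (t.1 t.2.1).val = 0 ∧ (t.1 t.2.2).val = 0 ∧
    ∀ u v, H.Adj u v → t.1 u = t.1 v → (u = t.2.1 ∧ v = t.2.2) ∨ (u = t.2.2 ∧ v = t.2.1)}

theorem colorable_of_forall_ne {H : SimpleGraph V} {r : ℕ} (c : V → Fin r)
    (hc : ∀ u v, H.Adj u v → c u ≠ c v) : H.Colorable r :=
  ⟨Coloring.mk c fun {u v} h => hc u v h⟩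

theorem not_colorable_of_chromaticNumber_eq {H : SimpleGraph V} {r : ℕ}
    (hχ : H.chromaticNumber = (r : ℕ∞) + 1) : ¬ H.Colorable r := fun h => by
  have := chromaticNumber_le_iff_colorable.2 h
  rw [hχ] at this
  exact absurd this (by exact_mod_cast Nat.not_succ_le_self r)

theorem nonempty_defectColoring {H : SimpleGraph V} {r : ℕ} (hr : 0 < r)
    (hχ : H.chromaticNumber = (r : ℕ∞) + 1) (hcrit : EdgeCritical H) :
    Nonempty (DefectColoring H r) := by
  obtain ⟨e, he, hlt⟩ := hcrit
  induction e using Sym2.ind with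
  | h a b =>
  rw [hχ] at hlt
  have hcol : (H.deleteEdges {s(a, b)}).Colorable r :=
    chromaticNumber_le_iff_colorable.1 (Order.le_of_lt_add_one hlt)
  obtain ⟨c⟩ := hcol
  have hnot := not_colorable_of_chromaticNumber_eq hχ
  have hc : ∀ u v, H.Adj u v → c u = c v → (u = a ∧ v = b) ∨ (u = b ∧ v = a) := by
    intro u v huv h
    by_contra hne
    refine c.valid (v := u) (w := v) ?_ h
    rw [deleteEdges_adj]
    exact ⟨huv, by simpa using hne⟩
  have hab : c a = c b := by
    by_contra hne
    refine hnot (colorable_of_forall_ne c fun u v huv h => ?_)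
    rcases hc u v huv h with ⟨rfl, rfl⟩ | ⟨rfl, rfl⟩
    · exact hne h
    · exact hne h.symm
  let σ := Equiv.swap (c a) (⟨0, hr⟩ : Fin r)
  refine ⟨⟨(fun v => σ (c v), a, b), he, ?_, ?_, fun u v huv h => hc u v huv (σ.injective h)⟩⟩
  · simp [σ]
  · simp [σ, ← hab]

open Classical in
/-- The vertex map with colour classes `t` sending the defect edge to the extra edge and the
other vertices to the positions given by `g`. -/
noncomputable def DefectColoring.vertexMap {H : SimpleGraph V} {r m : ℕ} (t : DefectColoring H r)
    (g : {x // x ≠ t.1.2.1 ∧ x ≠ t.1.2.2} → Fin (m + 2)) (v : V) : Fin r × Fin (m + 2) :=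
  (t.1.1 v, if ha : v = t.1.2.1 then 0 else if hb : v = t.1.2.2 then 1 else g ⟨v, ha, hb⟩)

theorem KrmPlus_adj {r m : ℕ} {u v : Fin r × Fin m} :
    (KrmPlus r m).Adj u v ↔ u.1 ≠ v.1 ∨ (u.1.val = 0 ∧ v.1.val = 0 ∧
      ((u.2.val = 0 ∧ v.2.val = 1) ∨ (u.2.val = 1 ∧ v.2.val = 0))) := by
  rw [KrmPlus, fromRel_adj, Ne, Prod.ext_iff, Fin.ext_iff, Fin.ext_iff]
  grind

theorem exists_vertexMap_eq {H : SimpleGraph V} {r m : ℕ} (hH : ¬ H.Colorable r)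
    (f : Copy H (KrmPlus r (m + 2))) :
    ∃ s : Σ t : DefectColoring H r, ({x // x ≠ t.1.2.1 ∧ x ≠ t.1.2.2} → Fin (m + 2)),
      ⇑f = s.1.vertexMap s.2 := by
  obtain ⟨a, b, hab, ha, hb, ha', hb'⟩ : ∃ a b, H.Adj a b ∧ (f a).1.val = 0 ∧ (f b).1.val = 0 ∧
      (f a).2.val = 0 ∧ (f b).2.val = 1 := by
    by_contra! hno
    refine hH (colorable_of_forall_ne (fun v => (f v).1) fun u v huv h => ?_)
    have h1 := KrmPlus_adj.1 (f.toHom.map_adj huv)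
    have h2 := hno u v huv
    have h3 := hno v u huv.symm
    simp only [Copy.toHom_apply] at h1
    grind
  have hinj : ∀ {u v}, (f u).1.val = (f v).1.val → (f u).2.val = (f v).2.val → u = v :=
    fun h h' => f.injective (Prod.ext (Fin.ext h) (Fin.ext h'))
  refine ⟨⟨⟨(fun v => (f v).1, a, b), hab, ha, hb, fun u v huv h => ?_⟩, fun x => (f x).2⟩, ?_⟩
  · have h1 := KrmPlus_adj.1 (f.toHom.map_adj huv)
    simp only [Copy.toHom_apply] at h1
    rcases h1 with h1 | ⟨hu, hv, ⟨hu', hv'⟩ | ⟨hu', hv'⟩⟩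
    · exact absurd h h1
    · exact .inl ⟨hinj (hu.trans ha.symm) (hu'.trans ha'.symm),
        hinj (hv.trans hb.symm) (hv'.trans hb'.symm)⟩
    · exact .inr ⟨hinj (hu.trans hb.symm) (hu'.trans hb'.symm),
        hinj (hv.trans ha.symm) (hv'.trans ha'.symm)⟩
  · funext v
    refine Prod.ext rfl ?_
    simp only [DefectColoring.vertexMap]
    split_ifs with h h'
    · subst h; exact Fin.ext ha'
    · subst h'; exact Fin.ext hb'
    · rfl

theorem DefectColoring.vertexMap_snd {H : SimpleGraph V} {r m : ℕ} (t : DefectColoring H r)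
    (g : {x // x ≠ t.1.2.1 ∧ x ≠ t.1.2.2} → Fin m) (v : V) :
    (v = t.1.2.1 ∧ (t.vertexMap (fun x => (g x).succ.succ) v).2.val = 0) ∨
    (v = t.1.2.2 ∧ (t.vertexMap (fun x => (g x).succ.succ) v).2.val = 1) ∨
    ∃ h : v ≠ t.1.2.1 ∧ v ≠ t.1.2.2,
      (t.vertexMap (fun x => (g x).succ.succ) v).2.val = (g ⟨v, h⟩).val + 2 := by
  have hne : t.1.2.1 ≠ t.1.2.2 := t.2.1.ne
  by_cases ha : v = t.1.2.1
  · exact .inl ⟨ha, by simp [vertexMap, ha]⟩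
  by_cases hb : v = t.1.2.2
  · exact .inr (.inl ⟨hb, by simp [vertexMap, hb, hne.symm]⟩)
  · exact .inr (.inr ⟨⟨ha, hb⟩, by simp [vertexMap, ha, hb]⟩)

/-- The copy of `H` given by a defect colouring and an injective choice of positions. -/
noncomputable def DefectColoring.toCopy {H : SimpleGraph V} {r m : ℕ} (t : DefectColoring H r)
    (g : {x // x ≠ t.1.2.1 ∧ x ≠ t.1.2.2} ↪ Fin m) : Copy H (KrmPlus r (m + 2)) where
  toHom := {
    toFun := t.vertexMap fun x => (g x).succ.succ
    map_rel' := by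
      intro u v huv
      have hne : t.1.2.1 ≠ t.1.2.2 := t.2.1.ne
      refine KrmPlus_adj.2 ?_
      by_cases h : t.1.1 u = t.1.1 v
      · refine .inr ?_
        have h0 : (t.1.1 t.1.2.1).val = 0 := t.2.2.1
        have h1 : (t.1.1 t.1.2.2).val = 0 := t.2.2.2.1
        rcases t.2.2.2.2 u v huv h with ⟨hu, hv⟩ | ⟨hu, hv⟩
        · simp [vertexMap, hu, hv, h0, h1, hne.symm]
        · simp [vertexMap, hu, hv, h0, h1, hne.symm]
      · exact .inl h }
  injective' := by
    intro u v h
    change t.vertexMap (fun x => (g x).succ.succ) u =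
      t.vertexMap (fun x => (g x).succ.succ) v at h
    have h2 := congrArg (fun p => p.2.val) h
    have hu := t.vertexMap_snd g u
    have hv := t.vertexMap_snd g v
    rcases hu with ⟨hu, hu'⟩ | ⟨hu, hu'⟩ | ⟨hu, hu'⟩ <;>
    rcases hv with ⟨hv, hv'⟩ | ⟨hv, hv'⟩ | ⟨hv, hv'⟩ <;>
    simp only [hu', hv'] at h2
    any_goals first
      | exact hu.trans hv.symm
      | omega
    exact congrArg Subtype.val (g.injective (Fin.ext (Nat.add_right_cancel h2)))

theorem DefectColoring.toCopy_injective {H : SimpleGraph V} {r m : ℕ} :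
    Function.Injective fun s : Σ t : DefectColoring H r,
      ({x // x ≠ t.1.2.1 ∧ x ≠ t.1.2.2} ↪ Fin m) => s.1.toCopy s.2 := by
  rintro ⟨⟨⟨c, a, b⟩, ht⟩, g⟩ ⟨⟨⟨c', a', b'⟩, ht'⟩, g'⟩ h
  have hv := fun v => DFunLike.congr_fun h v
  have hsnd := fun v => congrArg (fun p => p.2.val) (hv v)
  have hs := DefectColoring.vertexMap_snd ⟨(c, a, b), ht⟩ g
  have hs' := DefectColoring.vertexMap_snd ⟨(c', a', b'), ht'⟩ g'
  change ∀ v, (DefectColoring.vertexMap _ _ v).2.val =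
    (DefectColoring.vertexMap _ _ v).2.val at hsnd
  obtain rfl : c = c' := funext fun v => congrArg Prod.fst (hv v)
  simp only [hsnd] at hs
  obtain rfl : a = a' := by
    have := hs a
    have := hs' a
    have := ht.1.ne
    grind
  obtain rfl : b = b' := by
    have := hs b
    have := hs' b
    have := ht.1.ne
    grind
  obtain rfl : g = g' := by
    ext ⟨v, h1, h2⟩
    have := hs v
    have := hs' v
    grind
  rfl

theorem card_compl_pair [Fintype V] {a b : V} (hab : a ≠ b) :
    Nat.card {x // x ≠ a ∧ x ≠ b} = Fintype.card V - 2 := by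
  classical
  rw [Nat.card_eq_fintype_card, Fintype.card_subtype]
  have : (Finset.univ.filter fun x => x ≠ a ∧ x ≠ b) = ({a, b} : Finset V)ᶜ := by
    ext x; simp
  rw [this, Finset.card_compl, Finset.card_pair hab]

instance finite_copy [Finite V] [Finite W] (H : SimpleGraph V) (G : SimpleGraph W) :
    Finite (Copy H G) :=
  Finite.of_injective _ (DFunLike.coe_injective (F := Copy H G))

theorem card_copy_le [Fintype V] {H : SimpleGraph V} {r : ℕ} (hH : ¬ H.Colorable r) (m : ℕ) :
    Nat.card (Copy H (KrmPlus r (m + 2))) ≤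
      Nat.card (DefectColoring H r) * (m + 2) ^ (Fintype.card V - 2) := by
  classical
  choose s hs using exists_vertexMap_eq (m := m) hH
  have hinj : Function.Injective s := fun f f' h => DFunLike.coe_injective (by rw [hs, hs, h])
  have := Fintype.ofFinite (DefectColoring H r)
  refine (Nat.card_le_card_of_injective s hinj).trans_eq ?_
  rw [Nat.card_sigma, Finset.sum_congr rfl fun t _ => by
    rw [Nat.card_fun, Nat.card_fin, card_compl_pair t.2.1.ne]]
  rw [Finset.sum_const, smul_eq_mul, Finset.card_univ, Nat.card_eq_fintype_card]

theorem le_card_copy [Fintype V] (H : SimpleGraph V) (r m : ℕ) :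
    Nat.card (DefectColoring H r) * m.descFactorial (Fintype.card V - 2) ≤
      Nat.card (Copy H (KrmPlus r (m + 2))) := by
  classical
  have := Fintype.ofFinite (DefectColoring H r)
  refine Eq.trans_le ?_ (Nat.card_le_card_of_injective _
    (DefectColoring.toCopy_injective (H := H) (r := r) (m := m)))
  rw [Nat.card_sigma, Finset.sum_congr rfl fun t _ => by
    rw [Nat.card_eq_fintype_card, Fintype.card_embedding_eq, Fintype.card_fin,
      ← Nat.card_eq_fintype_card, card_compl_pair t.2.1.ne]]
  rw [Finset.sum_const, smul_eq_mul, Finset.card_univ, Nat.card_eq_fintype_card]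

end SimpleGraph

theorem tendsto_descFactorial_div_add_pow (j k : ℕ) :
    Tendsto (fun m : ℕ => (m.descFactorial k : ℝ) / ((m + j : ℕ) : ℝ) ^ k) atTop (𝓝 1) := by
  have h1 : Tendsto (fun m : ℕ => (m.descFactorial k : ℝ) / (m : ℝ) ^ k) atTop (𝓝 1) := by
    refine (Asymptotics.isEquivalent_iff_tendsto_one ?_).1 (isEquivalent_descFactorial k)
    filter_upwards [eventually_gt_atTop 0] with m hm
    positivity
  have h2 : Tendsto (fun m : ℕ => ((m : ℝ) / ((m : ℝ) + j)) ^ k) atTop (𝓝 1) := by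
    simpa using (tendsto_natCast_div_add_atTop (j : ℝ)).pow k
  refine (by simpa using h1.mul h2 : Tendsto _ _ _).congr' ?_
  filter_upwards [eventually_gt_atTop 0] with m hm
  have : (0 : ℝ) < m := by exact_mod_cast hm
  push_cast
  rw [div_pow]
  field_simp

theorem stmt16 {V : Type} [Fintype V] (H : SimpleGraph V) (r : ℕ) (hr : 2 ≤ r)
    (hχ : H.chromaticNumber = (r : ℕ∞) + 1) (hcrit : EdgeCritical H) :
    ∃ piH : ℝ, 0 < piH ∧
      Filter.Tendsto
        (fun m : ℕ => (copyCount H (KrmPlus r m) : ℝ) / (m : ℝ) ^ (Fintype.card V - 2))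
        atTop (nhds piH) := by
  have hcol := SimpleGraph.not_colorable_of_chromaticNumber_eq hχ
  have := SimpleGraph.nonempty_defectColoring (by omega) hχ hcrit
  have : Finite (H ≃g H) :=
    Finite.of_injective _ (RelIso.toEquiv_injective (r := H.Adj) (s := H.Adj))
  have : Nonempty (H ≃g H) := ⟨RelIso.refl _⟩
  set T := Nat.card (SimpleGraph.DefectColoring H r)
  set A := Nat.card (H ≃g H)
  have hT : (0 : ℝ) < T := by exact_mod_cast Nat.card_pos
  have hA : (0 : ℝ) < A := by exact_mod_cast Nat.card_pos
  refine ⟨T / A, div_pos hT hA, (tendsto_add_atTop_iff_nat 2).1 ?_⟩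
  have hcount : ∀ m : ℕ, (copyCount H (KrmPlus r (m + 2)) : ℝ) =
      Nat.card (H.Copy (KrmPlus r (m + 2))) / A := fun m => by
    rw [eq_div_iff hA.ne']
    exact_mod_cast (SimpleGraph.card_copy_eq_copyCount_mul H (KrmPlus r (m + 2))).symm
  have hlim := (tendsto_descFactorial_div_add_pow 2 (Fintype.card V - 2)).const_mul ((T : ℝ) / A)
  rw [mul_one] at hlim
  refine tendsto_of_tendsto_of_tendsto_of_le_of_le hlim tendsto_const_nhds
    (fun m => ?_) fun m => ?_
  · have h : (T : ℝ) * (m.descFactorial (Fintype.card V - 2) : ℝ) ≤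
        Nat.card (H.Copy (KrmPlus r (m + 2))) := by
      exact_mod_cast SimpleGraph.le_card_copy H r m
    dsimp only
    rw [hcount, div_mul_div_comm, div_div]
    push_cast
    gcongr
  · have h : (Nat.card (H.Copy (KrmPlus r (m + 2))) : ℝ) ≤
        T * ((m + 2 : ℕ) : ℝ) ^ (Fintype.card V - 2) := by
      exact_mod_cast SimpleGraph.card_copy_le hcol m
    dsimp only
    rw [hcount, div_div, div_le_div_iff₀ (by positivity) hA]
    calc _ ≤ T * ((m + 2 : ℕ) : ℝ) ^ (Fintype.card V - 2) * A := by gcongr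
      _ = _ := by ring
end
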